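/- Let C > 0 and ℓ ≥ 3 be fixed and let p : ℕ → (0,1] be any function. Let (G_n) be a sequence of graphs with |G_n| = n such that sup_n t_p(F,G_n) < ∞ for every finite tree F, for every F ∈ F_ℓ, and for F = C_{2ℓ−2}, the cycle of length 2ℓ−2. Suppose also that δ_□(G_n,κ) → 0 for some kernel κ : [0,1]² → [0,C]. Then t_p(F,G_n) → s(F,κ) as n → ∞ for each F ∈ F_ℓ. -/

import Mathlib

open MeasureTheory Set Filter
open scoped ENNReal Classical

noncomputable section

/-- The (0-based) index of the subinterval `((i)/n, (i+1)/n]` of `[0,1]` containing `x`. -/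
def idx (n : ℕ) (x : ℝ) : ℕ := ⌈x * n⌉₊ - 1

/-- The subset of `[0,1]` corresponding to a set of vertices of a graph on `Fin n`:
the union of the intervals `(i/n, (i+1)/n]` for `i ∈ X` (vertices `0`-indexed). -/
def vtxSet (n : ℕ) (X : Finset (Fin n)) : Set ℝ :=
  ⋃ i ∈ X, Ioc ((i : ℝ) / n) (((i : ℝ) + 1) / n)

/-- The kernel associated to a graph `G` on `{1,…,n}` and normalizing constant `p`:
it takes the value `1/p` on `((i−1)/n, i/n] × ((j−1)/n, j/n]` whenever `ij ∈ E(G)`,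
and `0` elsewhere. -/
def graphKernel {n : ℕ} (p : ℝ) (G : SimpleGraph (Fin n)) : ℝ → ℝ → ℝ := fun x y =>
  if h : x ∈ Ioc (0:ℝ) 1 ∧ y ∈ Ioc (0:ℝ) 1 ∧ idx n x < n ∧ idx n y < n then
    (if G.Adj ⟨idx n x, h.2.2.1⟩ ⟨idx n y, h.2.2.2⟩ then 1 / p else 0)
  else 0

/-- The cut norm of `W : [0,1]² → ℝ`. -/
def cutNorm (W : ℝ → ℝ → ℝ) : ℝ :=
  sSup {r | ∃ S T : Set ℝ, MeasurableSet S ∧ MeasurableSet T ∧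
    S ⊆ Icc 0 1 ∧ T ⊆ Icc 0 1 ∧ r = |∫ q in S ×ˢ T, W q.1 q.2|}

/-- `τ` is a Lebesgue-measure-preserving bijection of `[0,1]`. -/
def MPBij (τ : ℝ → ℝ) : Prop :=
  MeasurePreserving τ (volume.restrict (Icc 0 1)) (volume.restrict (Icc 0 1)) ∧
    BijOn τ (Icc 0 1) (Icc 0 1)

/-- The cut distance between two kernels. -/
def cutDist (κ₁ κ₂ : ℝ → ℝ → ℝ) : ℝ :=
  sInf {r | ∃ τ : ℝ → ℝ, MPBij τ ∧ r = cutNorm (fun x y => κ₁ x y - κ₂ (τ x) (τ y))}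

/-- The number of homomorphisms from `F` to `G`. -/
def homCount {α β : Type*} (F : SimpleGraph α) (G : SimpleGraph β) : ℕ :=
  Nat.card (F →g G)

/-- The number of injective homomorphisms (embeddings) from `F` to `G`. -/
def embCount {α β : Type*} (F : SimpleGraph α) (G : SimpleGraph β) : ℕ :=
  Nat.card {φ : F →g G // Function.Injective φ}

/-- The number of edges of a graph. -/
def edgeCount {α : Type*} (F : SimpleGraph α) : ℕ := Nat.card F.edgeSet

/-- The normalized homomorphism count `t_p(F,G)`. -/
def tDen {α β : Type*} [Fintype α] [Fintype β] (p : ℝ) (F : SimpleGraph α)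
    (G : SimpleGraph β) : ℝ :=
  homCount F G / (p ^ edgeCount F * (Fintype.card β : ℝ) ^ Fintype.card α)

/-- The normalized embedding count `s_p(F,G)`. -/
def sDen {α β : Type*} [Fintype α] [Fintype β] (p : ℝ) (F : SimpleGraph α)
    (G : SimpleGraph β) : ℝ :=
  embCount F G / (p ^ edgeCount F * ((Fintype.card β).descFactorial (Fintype.card α) : ℝ))

/-- The homomorphism density `s(F,κ)` of a finite graph in a kernel. -/
def homDensity {α : Type*} [Fintype α] (F : SimpleGraph α) (κ : ℝ → ℝ → ℝ) : ℝ :=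
  ∫ x in Set.univ.pi (fun _ : α => Icc (0:ℝ) 1),
    ∏ e ∈ F.edgeFinset,
      Sym2.lift ⟨fun i j => (κ (x i) (x j) + κ (x j) (x i)) / 2,
        fun i j => by dsimp only; rw [add_comm (κ (x i) (x j)) (κ (x j) (x i))]⟩ e

/-- The homomorphism density as a lower integral (for possibly unbounded kernels). -/
def homDensityL {α : Type*} [Fintype α] (F : SimpleGraph α) (κ : ℝ → ℝ → ℝ) : ℝ≥0∞ :=
  ∫⁻ x in Set.univ.pi (fun _ : α => Icc (0:ℝ) 1),
    ∏ e ∈ F.edgeFinset,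
      Sym2.lift ⟨fun i j => ENNReal.ofReal ((κ (x i) (x j) + κ (x j) (x i)) / 2),
        fun i j => by dsimp only; rw [add_comm (κ (x i) (x j)) (κ (x j) (x i))]⟩ e

/-- A kernel: a symmetric measurable function `[0,1]² → [0,∞)`. -/
def IsKernel (κ : ℝ → ℝ → ℝ) : Prop :=
  Measurable (Function.uncurry κ) ∧ (∀ x y, κ x y = κ y x) ∧ ∀ x y, 0 ≤ κ x y

/-- A kernel taking values in `[0,C]`. -/
def IsKernelBdd (κ : ℝ → ℝ → ℝ) (C : ℝ) : Prop :=
  Measurable (Function.uncurry κ) ∧ (∀ x y, κ x y = κ y x) ∧ ∀ x y, κ x y ∈ Icc 0 C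

/-- A standard kernel: a symmetric measurable function `[0,1]² → [0,1]`. -/
def IsStdKernel (κ : ℝ → ℝ → ℝ) : Prop := IsKernelBdd κ 1

/-- A doubly stochastic measure: a Borel measure on `[0,1]²` both of whose marginals
are Lebesgue measure on `[0,1]`. -/
def IsDoublyStochastic (μ : Measure (ℝ × ℝ)) : Prop :=
  μ.map Prod.fst = volume.restrict (Icc 0 1) ∧ μ.map Prod.snd = volume.restrict (Icc 0 1)

/-- The quantity `d_μ(κ₁,κ₂)`. -/
def dMu (μ : Measure (ℝ × ℝ)) (κ₁ κ₂ : ℝ → ℝ → ℝ) : ℝ :=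
  sSup {r | ∃ S T : Set (ℝ × ℝ), MeasurableSet S ∧ MeasurableSet T ∧
    S ⊆ Icc 0 1 ×ˢ Icc 0 1 ∧ T ⊆ Icc 0 1 ×ˢ Icc 0 1 ∧
    r = |∫ w in S ×ˢ T, (κ₁ w.1.1 w.2.1 - κ₂ w.1.2 w.2.2) ∂(μ.prod μ)|}

/-- Equivalence of kernels via a coupling. -/
def KernelEquiv (κ₁ κ₂ : ℝ → ℝ → ℝ) : Prop :=
  ∃ μ : Measure (ℝ × ℝ), IsDoublyStochastic μ ∧
    ∀ᵐ w ∂(μ.prod μ), κ₁ w.1.1 w.2.1 = κ₂ w.1.2 w.2.2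

/-- `e_G(A,B)`: the number of ordered pairs `(i,j) ∈ A × B` with `ij ∈ E(G)`. -/
def ePairs {n : ℕ} (G : SimpleGraph (Fin n)) (A B : Finset (Fin n)) : ℕ :=
  ((A ×ˢ B).filter fun q => G.Adj q.1 q.2).card

/-- The normalized density `d_p(A,B)`. -/
def dDens {n : ℕ} (p : ℝ) (G : SimpleGraph (Fin n)) (A B : Finset (Fin n)) : ℝ :=
  ePairs G A B / (p * A.card * B.card)

/-- A sequence of graphs has density bounded by `C`. -/
def DensityBoundedBy (p : ℕ → ℝ) (G : ∀ n, SimpleGraph (Fin n)) (C : ℝ) : Prop :=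
  ∀ ε > (0:ℝ), ∀ δ > (0:ℝ), ∀ᶠ n in atTop, ∀ A B : Finset (Fin n),
    ε * n ≤ A.card → ε * n ≤ B.card → dDens (p n) (G n) A B ≤ C + δ

/-- The parts of a partition of `Fin n` indexed by `Fin k`, given as a colouring. -/
def fiber {n k : ℕ} (c : Fin n → Fin k) (a : Fin k) : Finset (Fin n) :=
  Finset.univ.filter fun v => c v = a

/-- The finite-type kernel `G/Π` associated to a partition of the vertex set of `G`. -/
def partKernel {n k : ℕ} (p : ℝ) (G : SimpleGraph (Fin n)) (c : Fin n → Fin k) :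
    ℝ → ℝ → ℝ := fun x y =>
  if h : x ∈ Ioc (0:ℝ) 1 ∧ y ∈ Ioc (0:ℝ) 1 ∧ idx n x < n ∧ idx n y < n then
    dDens p G (fiber c (c ⟨idx n x, h.2.2.1⟩)) (fiber c (c ⟨idx n y, h.2.2.2⟩))
  else 0

/-- A partition is weakly `(ε,p)`-regular for `G`. -/
def WeaklyRegular {n k : ℕ} (p ε : ℝ) (G : SimpleGraph (Fin n)) (c : Fin n → Fin k) : Prop :=
  cutNorm (fun x y => graphKernel p G x y - partKernel p G c x y) ≤ ε

/-- `(A,B)` is an `(ε,p)`-regular pair for `G`. -/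
def RegPair {n : ℕ} (p ε : ℝ) (G : SimpleGraph (Fin n)) (A B : Finset (Fin n)) : Prop :=
  ∀ A' ⊆ A, ∀ B' ⊆ B, ε * A.card ≤ A'.card → ε * B.card ≤ B'.card →
    |dDens p G A' B' - dDens p G A B| ≤ ε

/-- An `(ε,p)`-regular partition of `G` into `k` parts. -/
def RegPartition {n k : ℕ} (p ε : ℝ) (G : SimpleGraph (Fin n)) (c : Fin n → Fin k) : Prop :=
  (∀ a : Fin k, (fiber c a).card = n / k ∨ (fiber c a).card = n / k + 1) ∧
  ((Finset.univ.filter (fun q : Fin k × Fin k =>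
      q.1 < q.2 ∧ ¬ RegPair p ε G (fiber c q.1) (fiber c q.2))).card : ℝ)
    ≤ ε * ((k : ℝ) * ((k : ℝ) - 1) / 2)

/-- The number of walks `v₀v₁⋯v_ℓ` in `G` with `v_i ∈ X_i` for each `i`. -/
def walkCount {n ℓ : ℕ} (G : SimpleGraph (Fin n)) (X : Fin (ℓ+1) → Finset (Fin n)) : ℕ :=
  Nat.card {v : Fin (ℓ+1) → Fin n //
    (∀ i, v i ∈ X i) ∧ ∀ i : Fin ℓ, G.Adj (v i.castSucc) (v i.succ)}

/-- `κ(X₀,X₁,…,X_ℓ)`: the kernel analogue of the walk count. -/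
def kernelWalk {ℓ : ℕ} (κ : ℝ → ℝ → ℝ) (X : Fin (ℓ+1) → Set ℝ) : ℝ :=
  ∫ x in Set.univ.pi X, ∏ i : Fin ℓ, κ (x i.castSucc) (x i.succ)

/-- `p_t(u,v)`: the number of paths of length `t` in `G` from `u` to `v`. -/
def pathCount {n : ℕ} (G : SimpleGraph (Fin n)) (t : ℕ) (u v : Fin n) : ℕ :=
  Nat.card {w : Fin (t+1) → Fin n // w 0 = u ∧ w (Fin.last t) = v ∧
    Function.Injective w ∧ ∀ i : Fin t, G.Adj (w i.castSucc) (w i.succ)}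

/-- The `i`-th vertex on the `r`-th subdivided edge (from `u r` to `v r`, `ℓ` steps). -/
def pv (ℓ : ℕ) {k m : ℕ} (u v : Fin m → Fin k) (r : Fin m) (i : ℕ) :
    Fin k ⊕ (Fin m × Fin (ℓ - 1)) :=
  if h0 : i = 0 then Sum.inl (u r)
  else if h : i < ℓ then Sum.inr (r, ⟨i - 1, by omega⟩)
  else Sum.inl (v r)

/-- The `(ℓ−1)`-fold subdivision of the loopless multigraph with `k` vertices and
edges `u r — v r` for `r < m`. -/
def multiSubdiv (ℓ : ℕ) {k m : ℕ} (u v : Fin m → Fin k) :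
    SimpleGraph (Fin k ⊕ (Fin m × Fin (ℓ - 1))) :=
  SimpleGraph.fromRel fun a b =>
    ∃ r : Fin m, ∃ i : ℕ, i < ℓ ∧ a = pv ℓ u v r i ∧ b = pv ℓ u v r (i + 1)

/-- Membership in the family `F_ℓ` of `(ℓ−1)`-fold subdivisions of finite loopless
multigraphs. -/
def InFamilyF (ℓ : ℕ) {N : ℕ} (F : SimpleGraph (Fin N)) : Prop :=
  ∃ (k m : ℕ) (u v : Fin m → Fin k), 1 ≤ k ∧ (∀ r, u r ≠ v r) ∧
    Nonempty (F ≃g multiSubdiv ℓ u v)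

/-- The edges of a simple graph on `Fin k`, as ordered pairs `(i,j)` with `i < j`. -/
abbrev edgeIdx {k : ℕ} (F : SimpleGraph (Fin k)) : Type :=
  {q : Fin k × Fin k // q.1 < q.2 ∧ F.Adj q.1 q.2}

/-- The `i`-th vertex on the subdivision of the edge `e` (`t` steps). -/
def spv (t : ℕ) {k : ℕ} {F : SimpleGraph (Fin k)} (e : edgeIdx F) (i : ℕ) :
    Fin k ⊕ (edgeIdx F × Fin (t - 1)) :=
  if h0 : i = 0 then Sum.inl e.1.1
  else if h : i < t then Sum.inr (e, ⟨i - 1, by omega⟩)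
  else Sum.inl e.1.2

/-- The `t`-subdivision `Sub_t(F)` of a simple graph `F`: each edge is replaced by a
path of length `t` through `t−1` new internal vertices. -/
def subdiv (t : ℕ) {k : ℕ} (F : SimpleGraph (Fin k)) :
    SimpleGraph (Fin k ⊕ (edgeIdx F × Fin (t - 1))) :=
  SimpleGraph.fromRel fun a b =>
    ∃ e : edgeIdx F, ∃ i : ℕ, i < t ∧ a = spv t e i ∧ b = spv t e (i + 1)

/-- The `t`-th power kernel `κ^t`. -/
def kpow (κ : ℝ → ℝ → ℝ) : ℕ → ℝ → ℝ → ℝ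
  | 0 => fun _ _ => 0
  | 1 => κ
  | (n + 2) => fun x y => ∫ z in Icc (0:ℝ) 1, kpow κ (n + 1) x z * κ z y

/-- `φ : Fin ℓ → Fin n` is a homomorphism from `F` to `G`. -/
def IsHom {α β : Type*} (F : SimpleGraph α) (G : SimpleGraph β) (φ : α → β) : Prop :=
  ∀ i j, F.Adj i j → G.Adj (φ i) (φ j)

/-- `F` is flat over its induced subgraph `F'` on the first `ℓ` vertices, for the
sequence `(G_n)` with normalizing function `p`. -/
def FlatOver (p : ℕ → ℝ) (G : ∀ n, SimpleGraph (Fin n)) {k ℓ : ℕ} (h : ℓ ≤ k)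
    (F : SimpleGraph (Fin k)) : Prop :=
  ∀ ε > (0:ℝ), ∀ᶠ n in atTop,
    ((Finset.univ.filter (fun φ : Fin ℓ → Fin n =>
        IsHom (F.comap (Fin.castLE h)) (G n) φ ∧
        ε * ((n:ℝ) ^ (k - ℓ) * p n ^ (edgeCount F - edgeCount (F.comap (Fin.castLE h)))) <
          |((Finset.univ.filter (fun ψ : Fin k → Fin n =>
              IsHom F (G n) ψ ∧ ψ ∘ Fin.castLE h = φ)).card : ℝ) -
            (n:ℝ) ^ (k - ℓ) * p n ^ (edgeCount F - edgeCount (F.comap (Fin.castLE h)))|)).card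
      : ℝ)
      ≤ ε * ((Finset.univ.filter (fun φ : Fin ℓ → Fin n =>
          IsHom (F.comap (Fin.castLE h)) (G n) φ)).card : ℝ)

/-- The set of density matrices of balanced partitions of `V(G)` into `k` nonempty
parts. -/
def MsetG (k : ℕ) {n : ℕ} (p : ℝ) (G : SimpleGraph (Fin n)) : Set (Fin k → Fin k → ℝ) :=
  {M | ∃ c : Fin n → Fin k, Function.Surjective c ∧
    (∀ a b, (fiber c a).card ≤ (fiber c b).card + 1) ∧
    M = fun a b => dDens p G (fiber c a) (fiber c b)}

/-- The closed set of density matrices of partitions of `[0,1]` into `k` parts of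
measure `1/k`, for a kernel `κ`. -/
def MsetK (k : ℕ) (κ : ℝ → ℝ → ℝ) : Set (Fin k → Fin k → ℝ) :=
  closure {M | ∃ Q : Fin k → Set ℝ, (∀ a, MeasurableSet (Q a)) ∧
    (Pairwise fun a b => Disjoint (Q a) (Q b)) ∧ (⋃ a, Q a) = Icc 0 1 ∧
    (∀ a, volume (Q a) = 1 / (k : ℝ≥0∞)) ∧
    M = fun a b => (k : ℝ)^2 * ∫ q in (Q a) ×ˢ (Q b), κ q.1 q.2}

end

section Core

/-- A bounded measurable real function. -/
structure BddMeas {α : Type*} [MeasurableSpace α] (f : α → ℝ) : Prop where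
  meas : Measurable f
  bdd : ∃ c, ∀ x, |f x| ≤ c

namespace BddMeas

variable {α β : Type*} [MeasurableSpace α] [MeasurableSpace β] {f g : α → ℝ}

lemma const (c : ℝ) : BddMeas fun _ : α => c := ⟨measurable_const, |c|, fun _ => le_rfl⟩

lemma add (hf : BddMeas f) (hg : BddMeas g) : BddMeas fun x => f x + g x := by
  obtain ⟨a, ha⟩ := hf.bdd
  obtain ⟨b, hb⟩ := hg.bdd
  exact ⟨hf.meas.add hg.meas, a + b, fun x => (abs_add_le _ _).trans (add_le_add (ha x) (hb x))⟩

lemma mul (hf : BddMeas f) (hg : BddMeas g) : BddMeas fun x => f x * g x := by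
  obtain ⟨a, ha⟩ := hf.bdd
  obtain ⟨b, hb⟩ := hg.bdd
  refine ⟨hf.meas.mul hg.meas, a * b, fun x => ?_⟩
  rw [abs_mul]
  exact mul_le_mul (ha x) (hb x) (abs_nonneg _) ((abs_nonneg _).trans (ha x))

lemma const_mul (c : ℝ) (hf : BddMeas f) : BddMeas fun x => c * f x := (const c).mul hf

lemma sub (hf : BddMeas f) (hg : BddMeas g) : BddMeas fun x => f x - g x := by
  simpa [sub_eq_add_neg] using hf.add (hg.const_mul (-1))

lemma neg (hf : BddMeas f) : BddMeas fun x => - f x := by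
  simpa using hf.const_mul (-1)

lemma abs (hf : BddMeas f) : BddMeas fun x => |f x| := by
  obtain ⟨a, ha⟩ := hf.bdd
  exact ⟨hf.meas.abs, a, fun x => by simpa using ha x⟩

lemma pow (hf : BddMeas f) (k : ℕ) : BddMeas fun x => f x ^ k := by
  induction k with
  | zero => simpa using const 1
  | succ k ih => simpa [pow_succ] using ih.mul hf

lemma min (hf : BddMeas f) (hg : BddMeas g) : BddMeas fun x => min (f x) (g x) := by
  obtain ⟨a, ha⟩ := hf.bdd
  obtain ⟨b, hb⟩ := hg.bdd
  refine ⟨hf.meas.min hg.meas, a ⊔ b, fun x => abs_min_le_max_abs_abs.trans ?_⟩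
  exact max_le_max (ha x) (hb x)

lemma max (hf : BddMeas f) (hg : BddMeas g) : BddMeas fun x => max (f x) (g x) := by
  obtain ⟨a, ha⟩ := hf.bdd
  obtain ⟨b, hb⟩ := hg.bdd
  refine ⟨hf.meas.max hg.meas, a ⊔ b, fun x => abs_max_le_max_abs_abs.trans ?_⟩
  exact max_le_max (ha x) (hb x)

lemma comp (hf : BddMeas f) {φ : β → α} (hφ : Measurable φ) : BddMeas fun x => f (φ x) := by
  obtain ⟨a, ha⟩ := hf.bdd
  exact ⟨hf.meas.comp hφ, a, fun x => ha _⟩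

lemma finset_prod {ι : Type*} (s : Finset ι) {f : ι → α → ℝ} (hf : ∀ i ∈ s, BddMeas (f i)) :
    BddMeas fun x => ∏ i ∈ s, f i x := by
  induction s using Finset.induction_on with
  | empty => simpa using const 1
  | insert a s ha ih =>
    simp only [Finset.prod_insert ha]
    exact (hf a (by simp)).mul (ih fun i hi => hf i (by simp [hi]))

lemma list_prod {ι : Type*} (L : List ι) {f : ι → α → ℝ} (hf : ∀ i ∈ L, BddMeas (f i)) :
    BddMeas fun x => (L.map fun i => f i x).prod := by
  induction L with
  | nil => simpa using const 1
  | cons a L ih =>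
    simp only [List.map_cons, List.prod_cons]
    exact (hf a (by simp)).mul (ih fun i hi => hf i (by simp [hi]))

lemma integrable (hf : BddMeas f) (μ : Measure α) [IsFiniteMeasure μ] : Integrable f μ := by
  obtain ⟨a, ha⟩ := hf.bdd
  exact Integrable.of_bound hf.meas.aestronglyMeasurable a (Eventually.of_forall ha)

lemma integral {f : α → β → ℝ} (hf : BddMeas fun q : α × β => f q.1 q.2) (μ : Measure β)
    [IsFiniteMeasure μ] : BddMeas fun x => ∫ y, f x y ∂μ := by
  obtain ⟨a, ha⟩ := hf.bdd
  refine ⟨?_, a * μ.real univ, fun x => ?_⟩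
  · exact (hf.meas.stronglyMeasurable.integral_prod_right (f := f)).measurable
  · exact norm_integral_le_of_norm_le_const (f := f x) (Eventually.of_forall fun y => ha (x, y))

lemma slice_left {f : α → β → ℝ} (hf : BddMeas fun q : α × β => f q.1 q.2) (x : α) :
    BddMeas (f x) := hf.comp (measurable_prodMk_left (x := x))

lemma slice_right {f : α → β → ℝ} (hf : BddMeas fun q : α × β => f q.1 q.2) (y : β) :
    BddMeas fun x => f x y := hf.comp (measurable_prodMk_right (y := y))

lemma swap {f : α → β → ℝ} (hf : BddMeas fun q : α × β => f q.1 q.2) :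
    BddMeas fun q : β × α => f q.2 q.1 := hf.comp measurable_swap

lemma of_fst (hf : BddMeas f) : BddMeas fun q : α × β => f q.1 := hf.comp measurable_fst

lemma of_snd {g : β → ℝ} (hg : BddMeas g) : BddMeas fun q : α × β => g q.2 :=
  hg.comp measurable_snd

lemma integral_swap {f : α → β → ℝ} (hf : BddMeas fun q : α × β => f q.1 q.2)
    (μ : Measure α) (ν : Measure β) [IsFiniteMeasure μ] [IsFiniteMeasure ν] :
    ∫ x, ∫ y, f x y ∂ν ∂μ = ∫ y, ∫ x, f x y ∂μ ∂ν :=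
  integral_integral_swap (hf.integrable (μ.prod ν))

lemma integral_mono {μ : Measure α} [IsFiniteMeasure μ] (hf : BddMeas f) (hg : BddMeas g)
    (h : ∀ x, f x ≤ g x) : ∫ x, f x ∂μ ≤ ∫ x, g x ∂μ :=
  MeasureTheory.integral_mono (hf.integrable μ) (hg.integrable μ) h

lemma integral_add {μ : Measure α} [IsFiniteMeasure μ] (hf : BddMeas f) (hg : BddMeas g) :
    ∫ x, f x + g x ∂μ = ∫ x, f x ∂μ + ∫ x, g x ∂μ :=
  MeasureTheory.integral_add (hf.integrable μ) (hg.integrable μ)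

lemma integral_sub {μ : Measure α} [IsFiniteMeasure μ] (hf : BddMeas f) (hg : BddMeas g) :
    ∫ x, f x - g x ∂μ = ∫ x, f x ∂μ - ∫ x, g x ∂μ :=
  MeasureTheory.integral_sub (hf.integrable μ) (hg.integrable μ)

end BddMeas

variable {Ω : Type*} [MeasurableSpace Ω]

/-- A bounded measurable function of two variables. -/
abbrev BddKer (U : Ω → Ω → ℝ) : Prop := BddMeas fun q : Ω × Ω => U q.1 q.2

lemma BddKer.slice_left {U : Ω → Ω → ℝ} (hU : BddKer U) (x : Ω) : BddMeas (U x) :=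
  BddMeas.slice_left hU x

lemma BddKer.slice_right {U : Ω → Ω → ℝ} (hU : BddKer U) (y : Ω) : BddMeas fun x => U x y :=
  BddMeas.slice_right hU y

/-- Composition of kernels. -/
noncomputable def kcomp (μ : Measure Ω) (U V : Ω → Ω → ℝ) : Ω → Ω → ℝ :=
  fun x y => ∫ z, U x z * V z y ∂μ

/-- `kpw μ W t` is the `(t + 1)`-fold composition power of the kernel `W`. -/
noncomputable def kpw (μ : Measure Ω) (W : Ω → Ω → ℝ) : ℕ → Ω → Ω → ℝ
  | 0 => W
  | t + 1 => kcomp μ W (kpw μ W t)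

lemma BddKer.kcomp {μ : Measure Ω} [IsFiniteMeasure μ] {U V : Ω → Ω → ℝ} (hU : BddKer U)
    (hV : BddKer V) : BddKer (kcomp μ U V) := by
  refine BddMeas.integral (α := Ω × Ω) (β := Ω) (f := fun q z => U q.1 z * V z q.2) ?_ μ
  exact (hU.comp (φ := fun w : (Ω × Ω) × Ω => (w.1.1, w.2)) (by fun_prop)).mul
    (hV.comp (φ := fun w : (Ω × Ω) × Ω => (w.2, w.1.2)) (by fun_prop))

lemma BddKer.kpw {μ : Measure Ω} [IsFiniteMeasure μ] {W : Ω → Ω → ℝ} (hW : BddKer W) (t : ℕ) :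
    BddKer (kpw μ W t) := by
  induction t with
  | zero => exact hW
  | succ t ih => exact hW.kcomp ih

lemma kcomp_assoc {μ : Measure Ω} [IsFiniteMeasure μ] {U V W : Ω → Ω → ℝ} (hU : BddKer U)
    (hV : BddKer V) (hW : BddKer W) :
    kcomp μ (kcomp μ U V) W = kcomp μ U (kcomp μ V W) := by
  funext x y
  simp only [kcomp, ← integral_mul_const, ← integral_const_mul]
  rw [BddMeas.integral_swap]
  · simp only [mul_assoc]
  · exact ((hU.comp (φ := fun w : Ω × Ω => (x, w.2)) (by fun_prop)).mul
      (hV.comp (φ := fun w : Ω × Ω => (w.2, w.1)) (by fun_prop))).mul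
      (hW.comp (φ := fun w : Ω × Ω => (w.1, y)) (by fun_prop))

lemma kpw_succ_right {μ : Measure Ω} [IsFiniteMeasure μ] {W : Ω → Ω → ℝ} (hW : BddKer W)
    (t : ℕ) : kpw μ W (t + 1) = kcomp μ (kpw μ W t) W := by
  induction t with
  | zero => rfl
  | succ t ih =>
    calc kpw μ W (t + 1 + 1) = kcomp μ W (kcomp μ (kpw μ W t) W) := by rw [← ih]; rfl
      _ = kcomp μ (kpw μ W (t + 1)) W := (kcomp_assoc hW (hW.kpw t) hW).symm

lemma kcomp_nonneg {μ : Measure Ω} {U V : Ω → Ω → ℝ} (hU : ∀ x y, 0 ≤ U x y)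
    (hV : ∀ x y, 0 ≤ V x y) (x y : Ω) : 0 ≤ kcomp μ U V x y :=
  integral_nonneg fun z => mul_nonneg (hU x z) (hV z y)

lemma kpw_nonneg {μ : Measure Ω} {W : Ω → Ω → ℝ} (hW : ∀ x y, 0 ≤ W x y) (t : ℕ) :
    ∀ x y, 0 ≤ kpw μ W t x y := by
  induction t with
  | zero => exact hW
  | succ t ih => exact kcomp_nonneg hW ih

lemma kpw_le {μ : Measure Ω} [IsProbabilityMeasure μ] {W : Ω → Ω → ℝ} (hW : BddKer W) {C : ℝ}
    (h0 : ∀ x y, 0 ≤ W x y) (hC : ∀ x y, W x y ≤ C) (t : ℕ) :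
    ∀ x y, kpw μ W t x y ≤ C ^ (t + 1) := by
  induction t with
  | zero => simpa [kpw] using hC
  | succ t ih =>
    intro x y
    have hb : BddMeas fun z => W x z * kpw μ W t z y :=
      (hW.slice_left x).mul ((hW.kpw t).slice_right y)
    calc kpw μ W (t + 1) x y ≤ ∫ _, C * C ^ (t + 1) ∂μ :=
          hb.integral_mono (.const _) fun z => mul_le_mul (hC x z) (ih z y)
            (kpw_nonneg h0 t z y) ((h0 x z).trans (hC x z))
      _ = C ^ (t + 1 + 1) := by simp [pow_succ']

end Core

section Cut

variable {Ω : Type*} [MeasurableSpace Ω] {μ : Measure Ω}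

lemma integral_max_zero_eq {ψ : Ω → ℝ} (hψ : BddMeas ψ) :
    ∫ x, max (ψ x) 0 ∂μ = ∫ x in {x | 0 ≤ ψ x}, ψ x ∂μ := by
  rw [← integral_indicator (measurableSet_le measurable_const hψ.meas)]
  congr 1
  funext x
  by_cases h : 0 ≤ ψ x
  · simp [h]
  · simp [h, le_of_not_ge h]

variable [IsProbabilityMeasure μ]

lemma integral_mul_le_of_setIntegral_le {f ψ : Ω → ℝ} (hf : BddMeas f) (hψ : BddMeas ψ) {T ε : ℝ}
    (h0 : ∀ x, 0 ≤ f x) (hT : ∀ x, f x ≤ T) (hT0 : 0 ≤ T)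
    (hS : ∀ S, MeasurableSet S → ∫ x in S, ψ x ∂μ ≤ ε) : ∫ x, f x * ψ x ∂μ ≤ T * ε := by
  calc ∫ x, f x * ψ x ∂μ ≤ ∫ x, T * max (ψ x) 0 ∂μ := by
        refine (hf.mul hψ).integral_mono ((hψ.max (.const 0)).const_mul T) fun x => ?_
        calc f x * ψ x ≤ f x * max (ψ x) 0 := mul_le_mul_of_nonneg_left (le_max_left _ _) (h0 x)
          _ ≤ T * max (ψ x) 0 := mul_le_mul_of_nonneg_right (hT x) (le_max_right _ _)
    _ = T * ∫ x in {x | 0 ≤ ψ x}, ψ x ∂μ := by rw [integral_const_mul, integral_max_zero_eq hψ]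
    _ ≤ T * ε :=
        mul_le_mul_of_nonneg_left (hS _ (measurableSet_le measurable_const hψ.meas)) hT0

lemma abs_integral_mul_le_of_abs_setIntegral_le {f ψ : Ω → ℝ} (hf : BddMeas f) (hψ : BddMeas ψ)
    {T ε : ℝ} (h0 : ∀ x, 0 ≤ f x) (hT : ∀ x, f x ≤ T) (hT0 : 0 ≤ T)
    (hS : ∀ S, MeasurableSet S → |∫ x in S, ψ x ∂μ| ≤ ε) : |∫ x, f x * ψ x ∂μ| ≤ T * ε := by
  refine abs_le'.2 ⟨integral_mul_le_of_setIntegral_le hf hψ h0 hT hT0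
    fun S hm => (le_abs_self _).trans (hS S hm), ?_⟩
  have := integral_mul_le_of_setIntegral_le (μ := μ) hf hψ.neg h0 hT hT0 (ε := ε)
    fun S hm => by rw [integral_neg]; exact (neg_le_abs _).trans (hS S hm)
  simpa [integral_neg] using this

/-- A kernel with small cut norm maps bounded functions to functions with small `L¹` norm. -/
lemma integral_abs_integral_mul_le {D : Ω → Ω → ℝ} (hD : BddKer D) {ε : ℝ}
    (hcut : ∀ S T, MeasurableSet S → MeasurableSet T → |∫ x in S, ∫ y in T, D x y ∂μ ∂μ| ≤ ε)
    {f : Ω → ℝ} (hf : BddMeas f) {T : ℝ} (h0 : ∀ x, 0 ≤ f x) (hT : ∀ x, f x ≤ T) (hT0 : 0 ≤ T) :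
    ∫ y, |∫ x, f x * D x y ∂μ| ∂μ ≤ 2 * (T * ε) := by
  have hfD : BddMeas fun q : Ω × Ω => f q.1 * D q.1 q.2 := hf.of_fst.mul hD
  have hφ : BddMeas fun y => ∫ x, f x * D x y ∂μ :=
    BddMeas.integral (f := fun y x => f x * D x y)
      (BddMeas.swap (f := fun x y => f x * D x y) hfD) μ
  have key : ∀ S, MeasurableSet S → |∫ y in S, ∫ x, f x * D x y ∂μ ∂μ| ≤ T * ε := by
    intro S hS
    rw [← BddMeas.integral_swap (f := fun x y => f x * D x y) hfD μ (μ.restrict S)]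
    simp only [integral_const_mul]
    exact abs_integral_mul_le_of_abs_setIntegral_le hf (hD.integral (μ.restrict S)) h0 hT hT0
      fun R hR => hcut R S hR hS
  have hm : ∀ ψ : Ω → ℝ, BddMeas ψ → (∀ S, MeasurableSet S → ∫ y in S, ψ y ∂μ ≤ T * ε) →
      ∫ y, max (ψ y) 0 ∂μ ≤ T * ε := fun ψ hψ h => by
    rw [integral_max_zero_eq hψ]
    exact h _ (measurableSet_le measurable_const hψ.meas)
  have h1 := hm _ hφ fun S hS => (le_abs_self _).trans (key S hS)
  have h2 := hm _ hφ.neg fun S hS => by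
    rw [integral_neg]; exact (neg_le_abs _).trans (key S hS)
  calc ∫ y, |∫ x, f x * D x y ∂μ| ∂μ
      = ∫ y, (max (∫ x, f x * D x y ∂μ) 0 + max (-∫ x, f x * D x y ∂μ) 0) ∂μ := by
        congr 1
        funext y
        exact (max_zero_add_max_neg_zero_eq_abs_self _).symm
    _ ≤ 2 * (T * ε) := by
        rw [(hφ.max (.const 0)).integral_add (hφ.neg.max (.const 0))]
        linarith

end Cut

section Moments

variable {Ω : Type*} [MeasurableSpace Ω] {μ : Measure Ω}

/-- Nonnegative bounded measurable functions, all of whose moments are uniformly bounded. -/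
structure MomBdd (μ : Measure Ω) (g : ℕ → Ω → ℝ) : Prop where
  bm : ∀ n, BddMeas (g n)
  nonneg : ∀ n x, 0 ≤ g n x
  mom : ∀ k : ℕ, ∃ M, ∀ n, ∫ x, g n x ^ k ∂μ ≤ M

namespace MomBdd

variable {f g : ℕ → Ω → ℝ}

lemma integral_le (hg : MomBdd μ g) : ∃ M, ∀ n, ∫ x, g n x ∂μ ≤ M := by
  simpa using hg.mom 1

variable [IsProbabilityMeasure μ]

lemma mono (hg : MomBdd μ g) (hf : ∀ n, BddMeas (f n)) (h0 : ∀ n x, 0 ≤ f n x)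
    (h : ∀ n x, f n x ≤ g n x) : MomBdd μ f := by
  refine ⟨hf, h0, fun k => ?_⟩
  obtain ⟨M, hM⟩ := hg.mom k
  exact ⟨M, fun n => (((hf n).pow k).integral_mono ((hg.bm n).pow k)
    fun x => pow_le_pow_left₀ (h0 n x) (h n x) k).trans (hM n)⟩

lemma mul (hf : MomBdd μ f) (hg : MomBdd μ g) : MomBdd μ fun n x => f n x * g n x := by
  refine ⟨fun n => (hf.bm n).mul (hg.bm n), fun n x => mul_nonneg (hf.nonneg n x) (hg.nonneg n x),
    fun k => ?_⟩
  obtain ⟨M, hM⟩ := hf.mom (k * 2)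
  obtain ⟨N, hN⟩ := hg.mom (k * 2)
  refine ⟨M + N, fun n => ?_⟩
  calc ∫ x, (f n x * g n x) ^ k ∂μ ≤ ∫ x, (f n x ^ (k * 2) + g n x ^ (k * 2)) ∂μ := by
        refine (((hf.bm n).mul (hg.bm n)).pow k).integral_mono
          (((hf.bm n).pow _).add ((hg.bm n).pow _)) fun x => ?_
        rw [mul_pow, pow_mul, pow_mul]
        nlinarith [sq_nonneg (f n x ^ k - g n x ^ k), sq_nonneg (f n x ^ k),
          sq_nonneg (g n x ^ k)]
    _ ≤ M + N := by
        rw [((hf.bm n).pow _).integral_add ((hg.bm n).pow _)]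
        exact add_le_add (hM n) (hN n)

lemma add (hf : MomBdd μ f) (hg : MomBdd μ g) : MomBdd μ fun n x => f n x + g n x := by
  refine ⟨fun n => (hf.bm n).add (hg.bm n), fun n x => add_nonneg (hf.nonneg n x) (hg.nonneg n x),
    fun k => ?_⟩
  obtain ⟨M, hM⟩ := hf.mom k
  obtain ⟨N, hN⟩ := hg.mom k
  refine ⟨2 ^ (k - 1) * (M + N), fun n => ?_⟩
  calc ∫ x, (f n x + g n x) ^ k ∂μ ≤ ∫ x, 2 ^ (k - 1) * (f n x ^ k + g n x ^ k) ∂μ :=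
        (((hf.bm n).add (hg.bm n)).pow k).integral_mono
          ((((hf.bm n).pow _).add ((hg.bm n).pow _)).const_mul _) fun x =>
          add_pow_le (hf.nonneg n x) (hg.nonneg n x) k
    _ ≤ 2 ^ (k - 1) * (M + N) := by
        rw [integral_const_mul, ((hf.bm n).pow _).integral_add ((hg.bm n).pow _)]
        exact mul_le_mul_of_nonneg_left (add_le_add (hM n) (hN n)) (by positivity)

lemma const {c : ℝ} (hc : 0 ≤ c) : MomBdd μ fun _ _ => c :=
  ⟨fun _ => .const c, fun _ _ => hc, fun k => ⟨c ^ k, fun n => by simp⟩⟩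

lemma pow (hf : MomBdd μ f) (k : ℕ) : MomBdd μ fun n x => f n x ^ k := by
  induction k with
  | zero => simpa using const zero_le_one
  | succ k ih => simpa [pow_succ] using ih.mul hf

end MomBdd

variable [IsProbabilityMeasure μ]

lemma pow_integral_mul_le {w g : Ω → ℝ} (hw : BddMeas w) (hg : BddMeas g) (hw0 : ∀ y, 0 ≤ w y)
    (hg0 : ∀ y, 0 ≤ g y) (j : ℕ) :
    (∫ y, w y * g y ∂μ) ^ (j + 1) ≤
      (∫ y, w y ∂μ + 1) ^ (j + 1) * ∫ y, w y * g y ^ (j + 1) ∂μ := by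
  set s := ∫ y, w y * g y ∂μ with hs
  set d := ∫ y, w y ∂μ with hd
  have hs0 : 0 ≤ s := integral_nonneg fun y => mul_nonneg (hw0 y) (hg0 y)
  have hd0 : 0 ≤ d := integral_nonneg hw0
  have key : ∀ y, s ^ j * (d + 1) * (w y * g y) ≤
      s ^ (j + 1) * w y + (d + 1) ^ (j + 1) * (w y * g y ^ (j + 1)) := by
    intro y
    have h1 : s ^ j * ((d + 1) * g y) ≤ s ^ (j + 1) + ((d + 1) * g y) ^ (j + 1) := by
      have hz : 0 ≤ (d + 1) * g y := mul_nonneg (by linarith) (hg0 y)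
      rcases le_total ((d + 1) * g y) s with h | h
      · have := mul_le_mul_of_nonneg_left h (pow_nonneg hs0 j)
        rw [pow_succ s]
        linarith [pow_nonneg hz (j + 1)]
      · have := mul_le_mul_of_nonneg_right (pow_le_pow_left₀ hs0 h j) hz
        rw [pow_succ ((d + 1) * g y)]
        linarith [pow_nonneg hs0 (j + 1)]
    have h2 := mul_le_mul_of_nonneg_left h1 (hw0 y)
    rw [mul_pow] at h2
    linarith
  have hint := ((hw.mul hg).const_mul (s ^ j * (d + 1))).integral_mono (μ := μ)
    ((hw.const_mul (s ^ (j + 1))).add ((hw.mul (hg.pow (j + 1))).const_mul ((d + 1) ^ (j + 1)))) key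
  rw [(hw.const_mul (s ^ (j + 1))).integral_add
    ((hw.mul (hg.pow (j + 1))).const_mul ((d + 1) ^ (j + 1))), integral_const_mul,
    integral_const_mul, integral_const_mul, ← hs, ← hd] at hint
  have : s ^ j * (d + 1) * s = s ^ (j + 1) * d + s ^ (j + 1) := by ring
  linarith

lemma tendsto_zero_of_le_const_mul_add {a ε : ℕ → ℝ} (ha : ∀ n, 0 ≤ a n)
    (hε : Tendsto ε atTop (nhds 0)) {M : ℝ}
    (h : ∀ δ : ℝ, 0 < δ → δ ≤ 1 → ∃ X, ∀ n, a n ≤ X * ε n + δ * M) :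
    Tendsto a atTop (nhds 0) := by
  rw [Metric.tendsto_atTop]
  intro η hη
  obtain ⟨X, hX⟩ := h (min 1 (η / (2 * (|M| + 1)))) (by positivity) (min_le_left _ _)
  have hM : min 1 (η / (2 * (|M| + 1))) * M ≤ η / 2 := by
    calc min 1 (η / (2 * (|M| + 1))) * M ≤ min 1 (η / (2 * (|M| + 1))) * (|M| + 1) :=
          mul_le_mul_of_nonneg_left ((le_abs_self M).trans (by linarith)) (by positivity)
      _ ≤ η / (2 * (|M| + 1)) * (|M| + 1) :=
          mul_le_mul_of_nonneg_right (min_le_right _ _) (by positivity)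
      _ = η / 2 := by field_simp
  have hXε : Tendsto (fun n => X * ε n) atTop (nhds 0) := by simpa using hε.const_mul X
  obtain ⟨N, hN⟩ := (hXε.eventually_lt_const (show (0 : ℝ) < η / 2 by positivity)).exists_forall_of_atTop
  refine ⟨N, fun n hn => ?_⟩
  rw [Real.dist_eq, sub_zero, abs_of_nonneg (ha n)]
  linarith [hX n, hN n hn]

end Moments

section Convergence

variable {Ω : Type*} [MeasurableSpace Ω]

/-- Sequences of kernels `A n` (with bounded degree moments) and `B n` (uniformly bounded by `C`)
whose difference tends to zero in cut norm. -/
structure CutClose (μ : Measure Ω) (A B : ℕ → Ω → Ω → ℝ) (C : ℝ) (ε : ℕ → ℝ) : Prop where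
  bmA : ∀ n, BddKer (A n)
  bmB : ∀ n, BddKer (B n)
  nonnegA : ∀ n x y, 0 ≤ A n x y
  nonnegB : ∀ n x y, 0 ≤ B n x y
  leB : ∀ n x y, B n x y ≤ C
  symmA : ∀ n x y, A n x y = A n y x
  symmB : ∀ n x y, B n x y = B n y x
  deg : MomBdd μ fun n x => ∫ y, A n x y ∂μ
  cut : ∀ n S T, MeasurableSet S → MeasurableSet T →
    |∫ x in S, ∫ y in T, (A n x y - B n x y) ∂μ ∂μ| ≤ ε n
  lim : Tendsto ε atTop (nhds 0)

namespace CutClose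

variable {μ : Measure Ω} {A B : ℕ → Ω → Ω → ℝ} {C : ℝ} {ε : ℕ → ℝ}

lemma bmD (h : CutClose μ A B C ε) (n : ℕ) : BddKer fun x y => A n x y - B n x y :=
  (h.bmA n).sub (h.bmB n)

/-- The row `L¹` norms of a kernel. -/
noncomputable def rowNorm (μ : Measure Ω) (U : Ω → Ω → ℝ) : Ω → ℝ := fun x => ∫ y, |U x y| ∂μ

lemma rowNorm_nonneg (U : Ω → Ω → ℝ) (x : Ω) : 0 ≤ rowNorm μ U x :=
  integral_nonneg fun _ => abs_nonneg _

variable [IsProbabilityMeasure μ]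

lemma C_nonneg (h : CutClose μ A B C ε) : 0 ≤ C := by
  obtain ⟨x⟩ : Nonempty Ω := nonempty_of_isProbabilityMeasure μ
  exact (h.nonnegB 0 x x).trans (h.leB 0 x x)

lemma momBdd_op (h : CutClose μ A B C ε) {g : ℕ → Ω → ℝ} (hg : MomBdd μ g) :
    MomBdd μ fun n x => ∫ y, A n x y * g n y ∂μ := by
  have hAg : ∀ n, BddMeas fun q : Ω × Ω => A n q.1 q.2 * g n q.2 :=
    fun n => (h.bmA n).mul (hg.bm n).of_snd
  have hbm : ∀ n, BddMeas fun x => ∫ y, A n x y * g n y ∂μ :=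
    fun n => BddMeas.integral (f := fun x y => A n x y * g n y) (hAg n) μ
  refine ⟨hbm, fun n x => integral_nonneg fun y => mul_nonneg (h.nonnegA n x y) (hg.nonneg n y),
    fun k => ?_⟩
  rcases k with _ | j
  · exact ⟨1, fun n => by simp⟩
  have hd1 := h.deg.add (MomBdd.const (μ := μ) zero_le_one)
  obtain ⟨M, hM⟩ := (h.deg.mul ((hd1.pow (j + 1)).pow 2)).integral_le
  obtain ⟨N, hN⟩ := (h.deg.mul ((hg.pow (j + 1)).pow 2)).integral_le
  refine ⟨M + N, fun n => ?_⟩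
  set d : Ω → ℝ := fun x => ∫ y, A n x y ∂μ with hd
  have hdm : BddMeas d := h.deg.bm n
  have hb1 : BddMeas fun q : Ω × Ω => A n q.1 q.2 * ((d q.1 + 1) ^ (j + 1)) ^ 2 :=
    (h.bmA n).mul ((hdm.add (.const 1)).pow (j + 1) |>.pow 2).of_fst
  have hb2 : BddMeas fun q : Ω × Ω => A n q.1 q.2 * (g n q.2 ^ (j + 1)) ^ 2 :=
    (h.bmA n).mul (((hg.bm n).pow (j + 1)).pow 2).of_snd
  have hb3 : BddMeas fun q : Ω × Ω => A n q.1 q.2 * g n q.2 ^ (j + 1) :=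
    (h.bmA n).mul ((hg.bm n).pow (j + 1)).of_snd
  have hi1 : BddMeas fun x => ∫ y, A n x y * ((d x + 1) ^ (j + 1)) ^ 2 ∂μ :=
    BddMeas.integral (f := fun x y => A n x y * ((d x + 1) ^ (j + 1)) ^ 2) hb1 μ
  have hi2 : BddMeas fun x => ∫ y, A n x y * (g n y ^ (j + 1)) ^ 2 ∂μ :=
    BddMeas.integral (f := fun x y => A n x y * (g n y ^ (j + 1)) ^ 2) hb2 μ
  have hi3 : BddMeas fun x => ∫ y, A n x y * g n y ^ (j + 1) ∂μ :=
    BddMeas.integral (f := fun x y => A n x y * g n y ^ (j + 1)) hb3 μ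
  calc ∫ x, (∫ y, A n x y * g n y ∂μ) ^ (j + 1) ∂μ
      ≤ ∫ x, (d x + 1) ^ (j + 1) * ∫ y, A n x y * g n y ^ (j + 1) ∂μ ∂μ :=
        ((hbm n).pow _).integral_mono (((hdm.add (.const 1)).pow _).mul hi3) fun x =>
          pow_integral_mul_le ((h.bmA n).slice_left x) (hg.bm n) (h.nonnegA n x) (hg.nonneg n) j
    _ ≤ ∫ x, (∫ y, A n x y * ((d x + 1) ^ (j + 1)) ^ 2 ∂μ
          + ∫ y, A n x y * (g n y ^ (j + 1)) ^ 2 ∂μ) ∂μ := by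
        refine (((hdm.add (.const 1)).pow _).mul hi3).integral_mono (hi1.add hi2) fun x => ?_
        rw [← integral_const_mul, ← ((hb1.slice_left (f := fun x y =>
          A n x y * ((d x + 1) ^ (j + 1)) ^ 2) x)).integral_add
          (hb2.slice_left (f := fun x y => A n x y * (g n y ^ (j + 1)) ^ 2) x)]
        refine ((hb3.slice_left (f := fun x y => A n x y * g n y ^ (j + 1)) x).const_mul
          _).integral_mono ((hb1.slice_left (f := fun x y =>
          A n x y * ((d x + 1) ^ (j + 1)) ^ 2) x).add
          (hb2.slice_left (f := fun x y => A n x y * (g n y ^ (j + 1)) ^ 2) x)) fun y => ?_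
        set a := (d x + 1) ^ (j + 1)
        set b := g n y ^ (j + 1)
        have : a * b ≤ a ^ 2 + b ^ 2 := by
          nlinarith [sq_nonneg (a - b), sq_nonneg a, sq_nonneg b]
        have := mul_le_mul_of_nonneg_left this (h.nonnegA n x y)
        linarith
    _ = ∫ x, d x * ((d x + 1) ^ (j + 1)) ^ 2 ∂μ + ∫ x, d x * (g n x ^ (j + 1)) ^ 2 ∂μ := by
        rw [hi1.integral_add hi2,
          hb2.integral_swap (f := fun x y => A n x y * (g n y ^ (j + 1)) ^ 2) μ μ]
        simp only [integral_mul_const, hd]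
        congr 2
        funext x
        congr 2
        funext y
        exact h.symmA n y x
    _ ≤ M + N := add_le_add (hM n) (hN n)

lemma integral_op (h : CutClose μ A B C ε) {g : Ω → ℝ} (hg : BddMeas g) (n : ℕ) :
    ∫ x, ∫ y, A n x y * g y ∂μ ∂μ = ∫ y, (∫ x, A n y x ∂μ) * g y ∂μ := by
  rw [BddMeas.integral_swap (f := fun x y => A n x y * g y) ((h.bmA n).mul hg.of_snd) μ μ]
  simp only [integral_mul_const]
  congr 1
  funext y
  congr 2
  funext x
  exact h.symmA n x y

lemma tendsto_integral_op (h : CutClose μ A B C ε) {g : ℕ → Ω → ℝ} (hg : MomBdd μ g)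
    (hlim : Tendsto (fun n => ∫ x, g n x ∂μ) atTop (nhds 0)) :
    Tendsto (fun n => ∫ x, ∫ y, A n x y * g n y ∂μ ∂μ) atTop (nhds 0) := by
  obtain ⟨M, hM⟩ := ((h.deg.pow 2).mul hg).integral_le
  refine tendsto_zero_of_le_const_mul_add (M := M)
    (fun n => integral_nonneg ((h.momBdd_op hg).nonneg n)) hlim fun δ hδ _ => ⟨1 / δ, fun n => ?_⟩
  rw [h.integral_op (hg.bm n) n]
  have hb1 := (hg.bm n).const_mul (1 / δ)
  have hb2 := (((h.deg.bm n).pow 2).mul (hg.bm n)).const_mul δ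
  refine (((h.deg.bm n).mul (hg.bm n)).integral_mono (hb1.add hb2) fun x => ?_).trans ?_
  · have hd : ∀ d : ℝ, d ≤ 1 / δ + δ * d ^ 2 := fun d => by
      have : 1 / δ + δ * d ^ 2 - d = δ * ((d - 1 / (2 * δ)) ^ 2 + 3 / (4 * δ ^ 2)) := by
        field_simp
        ring
      have h2 : 0 ≤ δ * ((d - 1 / (2 * δ)) ^ 2 + 3 / (4 * δ ^ 2)) := by positivity
      linarith
    have := mul_le_mul_of_nonneg_right (hd (∫ y, A n x y ∂μ)) (hg.nonneg n x)
    linarith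
  · rw [hb1.integral_add hb2, integral_const_mul, integral_const_mul]
    exact add_le_add le_rfl (mul_le_mul_of_nonneg_left (hM n) hδ.le)

lemma bm_rowNorm {U : Ω → Ω → ℝ} (hU : BddKer U) : BddMeas (rowNorm μ U) :=
  BddMeas.integral (f := fun x y => |U x y|) hU.abs μ

lemma rowNorm_add_le {U V : Ω → Ω → ℝ} (hU : BddKer U) (hV : BddKer V) (x : Ω) :
    rowNorm μ (fun x y => U x y + V x y) x ≤ rowNorm μ U x + rowNorm μ V x := by
  rw [rowNorm, rowNorm, rowNorm, ← (hU.slice_left x).abs.integral_add (hV.slice_left x).abs]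
  exact ((hU.slice_left x).add (hV.slice_left x)).abs.integral_mono
    ((hU.slice_left x).abs.add (hV.slice_left x).abs) fun y => abs_add_le _ _

lemma rowNorm_kcomp_le {U V : Ω → Ω → ℝ} (hU : BddKer U) (hV : BddKer V) (x : Ω) :
    rowNorm μ (kcomp μ U V) x ≤ ∫ z, |U x z| * rowNorm μ V z ∂μ := by
  have hb : BddMeas fun q : Ω × Ω => |U x q.2| * |V q.2 q.1| :=
    (hU.slice_left x).abs.of_snd.mul (BddMeas.swap hV).abs
  calc rowNorm μ (kcomp μ U V) x ≤ ∫ y, ∫ z, |U x z| * |V z y| ∂μ ∂μ := by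
        refine ((hU.kcomp hV).slice_left x).abs.integral_mono
          (BddMeas.integral (f := fun y z => |U x z| * |V z y|) hb μ) fun y => ?_
        refine (abs_integral_le_integral_abs).trans (le_of_eq ?_)
        simp only [abs_mul]
    _ = ∫ z, |U x z| * rowNorm μ V z ∂μ := by
        rw [BddMeas.integral_swap (f := fun y z => |U x z| * |V z y|) hb μ μ]
        simp only [integral_const_mul, rowNorm]

lemma rowNorm_sub_le (h : CutClose μ A B C ε) (n : ℕ) (x : Ω) :
    rowNorm μ (fun x y => A n x y - B n x y) x ≤ ∫ y, A n x y ∂μ + C := by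
  have : ∫ y, A n x y ∂μ + C = ∫ y, (A n x y + C) ∂μ := by
    rw [((h.bmA n).slice_left x).integral_add (.const C)]
    simp
  rw [this]
  refine ((h.bmD n).slice_left x).abs.integral_mono
    (((h.bmA n).slice_left x).add (.const C)) fun y => ?_
  rw [abs_le]
  have := h.nonnegA n x y
  have := h.nonnegB n x y
  have := h.leB n x y
  constructor <;> linarith

lemma momBdd_rowNorm_diff (h : CutClose μ A B C ε) (t : ℕ) :
    MomBdd μ fun n => rowNorm μ (kcomp μ (fun x y => A n x y - B n x y) (kpw μ (B n) t)) := by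
  have hC := h.C_nonneg
  refine ((h.deg.add (.const hC)).mul (.const (pow_nonneg hC (t + 1)))).mono
    (fun n => bm_rowNorm ((h.bmD n).kcomp ((h.bmB n).kpw t))) (fun n => rowNorm_nonneg _)
    fun n x => (rowNorm_kcomp_le (h.bmD n) ((h.bmB n).kpw t) x).trans ?_
  have hrow : ∀ z, rowNorm μ (kpw μ (B n) t) z ≤ C ^ (t + 1) := fun z => by
    refine (((h.bmB n).kpw t).slice_left z).abs.integral_mono (.const (C ^ (t + 1)))
      (fun y => ?_) |>.trans (by simp)
    rw [abs_of_nonneg (kpw_nonneg (h.nonnegB n) t z y)]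
    exact kpw_le (h.bmB n) (h.nonnegB n) (h.leB n) t z y
  refine (((h.bmD n).slice_left x).abs.mul (bm_rowNorm ((h.bmB n).kpw t))).integral_mono
    (((h.bmD n).slice_left x).abs.mul (.const (C ^ (t + 1))))
    (fun z => mul_le_mul_of_nonneg_left (hrow z) (abs_nonneg _)) |>.trans ?_
  rw [integral_mul_const]
  exact mul_le_mul_of_nonneg_right (h.rowNorm_sub_le n x) (pow_nonneg hC _)

lemma tendsto_rowNorm_diff (h : CutClose μ A B C ε) (t : ℕ) :
    Tendsto (fun n => ∫ x, rowNorm μ (kcomp μ (fun x y => A n x y - B n x y) (kpw μ (B n) t)) x ∂μ)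
      atTop (nhds 0) := by
  have hC := h.C_nonneg
  have hlim : Tendsto (fun n => 2 * (C ^ (t + 1) * ε n)) atTop (nhds 0) := by
    simpa using (h.lim.const_mul (C ^ (t + 1))).const_mul 2
  refine squeeze_zero (fun n => integral_nonneg (rowNorm_nonneg _)) (fun n => ?_) hlim
  have hb : BddKer (kcomp μ (fun x y => A n x y - B n x y) (kpw μ (B n) t)) :=
    (h.bmD n).kcomp ((h.bmB n).kpw t)
  simp only [rowNorm]
  rw [BddMeas.integral_swap (f := fun x y =>
    |kcomp μ (fun x y => A n x y - B n x y) (kpw μ (B n) t) x y|) hb.abs μ μ]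
  have : ∀ y, ∫ x, |kcomp μ (fun x y => A n x y - B n x y) (kpw μ (B n) t) x y| ∂μ ≤
      2 * (C ^ (t + 1) * ε n) := fun y => by
    have := integral_abs_integral_mul_le (h.bmD n) (h.cut n) (((h.bmB n).kpw (μ := μ) t).slice_right y)
      (fun x => kpw_nonneg (h.nonnegB n) t x y)
      (fun x => kpw_le (h.bmB n) (h.nonnegB n) (h.leB n) t x y) (pow_nonneg hC _)
    refine le_trans (le_of_eq ?_) this
    simp only [kcomp]
    congr 1
    funext x
    congr 2
    funext z
    rw [h.symmA n x z, h.symmB n x z, mul_comm]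
  refine (BddMeas.integral_mono (BddMeas.integral (f := fun y x =>
    |kcomp μ (fun x y => A n x y - B n x y) (kpw μ (B n) t) x y|) (BddMeas.swap hb).abs μ)
    (.const (2 * (C ^ (t + 1) * ε n))) this).trans (by simp)

/-- The kernel `(A ^ (t + 1) - B ^ (t + 1)) B`. -/
noncomputable def mixedDiff (μ : Measure Ω) (U V : Ω → Ω → ℝ) (t : ℕ) : Ω → Ω → ℝ :=
  fun x y => kcomp μ (kpw μ U t) V x y - kpw μ V (t + 1) x y

lemma bm_mixedDiff {U V : Ω → Ω → ℝ} (hU : BddKer U) (hV : BddKer V) (t : ℕ) :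
    BddKer (mixedDiff μ U V t) := ((hU.kpw t).kcomp hV).sub (hV.kpw (t + 1))

lemma mixedDiff_zero {U V : Ω → Ω → ℝ} (hU : BddKer U) (hV : BddKer V) :
    mixedDiff μ U V 0 = kcomp μ (fun x y => U x y - V x y) (kpw μ V 0) := by
  funext x y
  simp only [mixedDiff, kpw, kcomp, sub_mul]
  exact (((hU.slice_left x).mul (hV.slice_right y)).integral_sub
    ((hV.slice_left x).mul (hV.slice_right y))).symm

lemma mixedDiff_succ {U V : Ω → Ω → ℝ} (hU : BddKer U) (hV : BddKer V) (t : ℕ) :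
    mixedDiff μ U V (t + 1) = fun x y => kcomp μ U (mixedDiff μ U V t) x y +
      kcomp μ (fun x y => U x y - V x y) (kpw μ V (t + 1)) x y := by
  funext x y
  have hP := (hV.kpw (μ := μ) (t + 1)).slice_right y
  have hQ := ((hU.kpw (μ := μ) t).kcomp (μ := μ) hV).slice_right y
  have h1 : kcomp μ U (mixedDiff μ U V t) x y =
      kcomp μ U (kcomp μ (kpw μ U t) V) x y - kcomp μ U (kpw μ V (t + 1)) x y := by
    rw [kcomp, kcomp, kcomp, ← ((hU.slice_left x).mul hQ).integral_sub ((hU.slice_left x).mul hP)]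
    simp only [mixedDiff, mul_sub]
  have h2 : kcomp μ (fun x y => U x y - V x y) (kpw μ V (t + 1)) x y =
      kcomp μ U (kpw μ V (t + 1)) x y - kcomp μ V (kpw μ V (t + 1)) x y := by
    rw [kcomp, kcomp, kcomp, ← ((hU.slice_left x).mul hP).integral_sub ((hV.slice_left x).mul hP)]
    simp only [sub_mul]
  rw [h1, h2, mixedDiff, kpw, kcomp_assoc hU (hU.kpw t) hV, kpw]
  ring

lemma rowNorm_mixedDiff (h : CutClose μ A B C ε) (t : ℕ) :
    MomBdd μ (fun n => rowNorm μ (mixedDiff μ (A n) (B n) t)) ∧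
      Tendsto (fun n => ∫ x, rowNorm μ (mixedDiff μ (A n) (B n) t) x ∂μ) atTop (nhds 0) := by
  induction t with
  | zero =>
    simp only [mixedDiff_zero (h.bmA _) (h.bmB _)]
    exact ⟨h.momBdd_rowNorm_diff 0, h.tendsto_rowNorm_diff 0⟩
  | succ t ih =>
    have hm := (h.momBdd_op ih.1).add (h.momBdd_rowNorm_diff (t + 1))
    have hbm := fun n => bm_rowNorm (μ := μ) (bm_mixedDiff (μ := μ) (h.bmA n) (h.bmB n) (t + 1))
    have hle : ∀ n x, rowNorm μ (mixedDiff μ (A n) (B n) (t + 1)) x ≤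
        ∫ y, A n x y * rowNorm μ (mixedDiff μ (A n) (B n) t) y ∂μ +
          rowNorm μ (kcomp μ (fun x y => A n x y - B n x y) (kpw μ (B n) (t + 1))) x := by
      intro n x
      have hb := bm_mixedDiff (μ := μ) (h.bmA n) (h.bmB n) t
      rw [mixedDiff_succ (h.bmA n) (h.bmB n)]
      refine (rowNorm_add_le ((h.bmA n).kcomp hb)
        ((h.bmD n).kcomp ((h.bmB n).kpw (t + 1))) x).trans (add_le_add ?_ le_rfl)
      refine (rowNorm_kcomp_le (h.bmA n) hb x).trans (le_of_eq ?_)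
      simp only [abs_of_nonneg (h.nonnegA n x _)]
    refine ⟨hm.mono hbm (fun n => rowNorm_nonneg _) hle, ?_⟩
    have hlim := (h.tendsto_integral_op ih.1 ih.2).add (h.tendsto_rowNorm_diff (t + 1))
    rw [add_zero] at hlim
    refine squeeze_zero (fun n => integral_nonneg (rowNorm_nonneg _)) (fun n => ?_) hlim
    rw [← ((h.momBdd_op ih.1).bm n).integral_add ((h.momBdd_rowNorm_diff (t + 1)).bm n)]
    exact (hbm n).integral_mono (hm.bm n) (hle n)

lemma sub_min_mul_le {δ K e : ℝ} (hδ : 0 < δ) :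
    (K - min K (1 / δ ^ 2)) * e ≤ δ * (2 * K ^ 2 + e ^ 4) := by
  rcases le_total K (1 / δ ^ 2) with h | h
  · rw [min_eq_left h, sub_self, zero_mul]
    positivity
  · rcases le_total e 0 with he | he
    · refine (mul_nonpos_of_nonneg_of_nonpos (sub_nonneg.2 (min_le_left _ _)) he).trans ?_
      positivity
    have h1 : (K - min K (1 / δ ^ 2)) * e ≤ K * e :=
      mul_le_mul_of_nonneg_right (by rw [min_eq_right h]; linarith [show 0 ≤ 1 / δ ^ 2 by positivity])
        he
    have h2 : K * e ≤ δ * K ^ 2 + e ^ 2 / δ := by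
      have : δ * K ^ 2 + e ^ 2 / δ - K * e = δ * ((K - e / (2 * δ)) ^ 2 + 3 * e ^ 2 / (4 * δ ^ 2)) := by
        field_simp
        ring
      have h2 : 0 ≤ δ * ((K - e / (2 * δ)) ^ 2 + 3 * e ^ 2 / (4 * δ ^ 2)) := by positivity
      linarith
    have h3 : e ^ 2 / δ ≤ δ * K ^ 2 + δ * e ^ 4 := by
      rw [div_le_iff₀ hδ]
      rcases le_total (δ * e) 1 with h4 | h4
      · have h5 : 1 ≤ δ ^ 2 * K := by
          rw [div_le_iff₀ (by positivity)] at h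
          linarith
        have h6 : δ * e ≤ δ ^ 2 * K := h4.trans h5
        have h7 : e ≤ δ * K := by
          have : δ * e ≤ δ * (δ * K) := by linarith [show δ * (δ * K) = δ ^ 2 * K by ring]
          exact le_of_mul_le_mul_left this hδ
        have h8 : e ^ 2 ≤ (δ * K) ^ 2 := pow_le_pow_left₀ he h7 2
        have h9 : 0 ≤ δ * e ^ 4 * δ := by positivity
        nlinarith
      · have h5 : 1 ≤ (δ * e) ^ 2 := one_le_pow₀ h4
        have h6 := mul_le_mul_of_nonneg_left h5 (sq_nonneg e)
        have h9 : 0 ≤ δ * K ^ 2 * δ := by positivity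
        nlinarith
    linarith

/-- Composing kernels that are bounded in `L²` with kernels that are small in cut norm gives kernels
that are small in `L¹`. -/
lemma tendsto_rowNorm_kcomp_diff (h : CutClose μ A B C ε) {K : ℕ → Ω → Ω → ℝ}
    (hK : ∀ n, BddKer (K n)) (hK0 : ∀ n x y, 0 ≤ K n x y) {M : ℝ}
    (hM : ∀ n, ∫ x, ∫ y, K n x y ^ 2 ∂μ ∂μ ≤ M) :
    Tendsto (fun n => ∫ x, rowNorm μ (kcomp μ (K n) fun x y => A n x y - B n x y) x ∂μ)
      atTop (nhds 0) := by
  have hdeg := h.deg.add (.const h.C_nonneg)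
  obtain ⟨N, hN⟩ := hdeg.mom 4
  refine tendsto_zero_of_le_const_mul_add (M := 2 * M + N)
    (fun n => integral_nonneg (rowNorm_nonneg _)) h.lim fun δ hδ _ => ⟨2 * (1 / δ ^ 2), fun n => ?_⟩
  set T := 1 / δ ^ 2 with hT
  have hT0 : 0 ≤ T := by positivity
  set e : Ω → ℝ := fun z => ∫ y, A n z y ∂μ + C with he
  have hebm : BddMeas e := hdeg.bm n
  set D : Ω → Ω → ℝ := fun x y => A n x y - B n x y with hD
  have hDb : BddKer D := h.bmD n
  have hLb : BddKer fun x z => min (K n x z) T := (hK n).min (.const T)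
  have hRb : BddKer fun x z => K n x z - min (K n x z) T := (hK n).sub hLb
  have hsplit : kcomp μ (K n) D = fun x y => kcomp μ (fun x z => min (K n x z) T) D x y +
      kcomp μ (fun x z => K n x z - min (K n x z) T) D x y := by
    funext x y
    rw [kcomp, kcomp, kcomp, ← ((hLb.slice_left x).mul (hDb.slice_right y)).integral_add
      ((hRb.slice_left x).mul (hDb.slice_right y))]
    congr 1
    funext z
    ring
  have hsq : BddMeas fun x => ∫ z, K n x z ^ 2 ∂μ :=
    BddMeas.integral (f := fun x z => K n x z ^ 2) ((hK n).pow 2) μ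
  have hpt : ∀ x, rowNorm μ (kcomp μ (K n) D) x ≤
      2 * (T * ε n) + δ * (2 * ∫ z, K n x z ^ 2 ∂μ + ∫ z, e z ^ 4 ∂μ) := by
    intro x
    rw [hsplit]
    refine (rowNorm_add_le (hLb.kcomp hDb) (hRb.kcomp hDb) x).trans (add_le_add ?_ ?_)
    · exact integral_abs_integral_mul_le hDb (h.cut n) (hLb.slice_left x)
        (fun z => le_min (hK0 n x z) hT0) (fun z => min_le_right _ _) hT0
    · refine (rowNorm_kcomp_le hRb hDb x).trans ?_
      have hb := ((((hK n).slice_left x).pow 2).const_mul 2).add (hebm.pow 4)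
      refine (((hRb.slice_left x).abs.mul (bm_rowNorm hDb)).integral_mono (hb.const_mul δ)
        fun z => ?_).trans (le_of_eq ?_)
      · have h0 : 0 ≤ K n x z - min (K n x z) T := sub_nonneg.2 (min_le_left _ _)
        rw [abs_of_nonneg h0]
        exact (mul_le_mul_of_nonneg_left (h.rowNorm_sub_le n z) h0).trans
          (sub_min_mul_le hδ)
      · rw [integral_const_mul, ((((hK n).slice_left x).pow 2).const_mul 2).integral_add
          (hebm.pow 4), integral_const_mul]
  have hb1 : BddMeas fun x => 2 * ∫ z, K n x z ^ 2 ∂μ + ∫ z, e z ^ 4 ∂μ :=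
    (hsq.const_mul 2).add (.const _)
  refine ((bm_rowNorm ((hK n).kcomp hDb)).integral_mono
    ((BddMeas.const (2 * (T * ε n))).add (hb1.const_mul δ)) hpt).trans ?_
  rw [(BddMeas.const (2 * (T * ε n))).integral_add (hb1.const_mul δ), integral_const_mul δ,
    (hsq.const_mul 2).integral_add (.const _), integral_const_mul 2 (fun x => ∫ z, K n x z ^ 2 ∂μ)]
  simp only [integral_const, probReal_univ, one_smul]
  have h1 : 2 * ∫ x, ∫ z, K n x z ^ 2 ∂μ ∂μ + ∫ z, e z ^ 4 ∂μ ≤ 2 * M + N :=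
    add_le_add (mul_le_mul_of_nonneg_left (hM n) zero_le_two) (hN n)
  have h2 := mul_le_mul_of_nonneg_left h1 hδ.le
  linarith

/-- If the `(s + 1)`-st powers of `A n` are bounded in `L²`, then the `(s + 2)`-nd powers of `A n`
and `B n` are close in `L¹`. -/
theorem tendsto_kpw_sub (h : CutClose μ A B C ε) (s : ℕ) {M : ℝ}
    (hM : ∀ n, ∫ x, ∫ y, kpw μ (A n) s x y ^ 2 ∂μ ∂μ ≤ M) :
    Tendsto (fun n => ∫ x, ∫ y, |kpw μ (A n) (s + 1) x y - kpw μ (B n) (s + 1) x y| ∂μ ∂μ)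
      atTop (nhds 0) := by
  have hK := fun n => (h.bmA n).kpw (μ := μ) s
  have hlim := (h.tendsto_rowNorm_kcomp_diff hK (fun n => kpw_nonneg (h.nonnegA n) s) hM).add
    (h.rowNorm_mixedDiff s).2
  rw [add_zero] at hlim
  refine squeeze_zero (fun n => integral_nonneg fun x => integral_nonneg fun y => abs_nonneg _)
    (fun n => ?_) hlim
  have hKD := (hK n).kcomp (μ := μ) (h.bmD n)
  have hmix := bm_mixedDiff (μ := μ) (h.bmA n) (h.bmB n) s
  have heq : (fun x y => kpw μ (A n) (s + 1) x y - kpw μ (B n) (s + 1) x y) = fun x y =>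
      kcomp μ (kpw μ (A n) s) (fun x y => A n x y - B n x y) x y +
        mixedDiff μ (A n) (B n) s x y := by
    funext x y
    rw [kpw_succ_right (h.bmA n), mixedDiff, kcomp, kcomp, kcomp]
    simp only [mul_sub]
    rw [(((hK n).slice_left x).mul ((h.bmA n).slice_right y)).integral_sub
      (((hK n).slice_left x).mul ((h.bmB n).slice_right y))]
    ring
  rw [← (bm_rowNorm hKD).integral_add (bm_rowNorm hmix)]
  have hsub := ((h.bmA n).kpw (μ := μ) (s + 1)).sub ((h.bmB n).kpw (μ := μ) (s + 1))
  refine (bm_rowNorm hsub).integral_mono ((bm_rowNorm hKD).add (bm_rowNorm hmix)) fun x => ?_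
  rw [heq]
  exact rowNorm_add_le hKD hmix x

end CutClose

end Convergence

section Multigraph

variable {Ω : Type*} {ι : Type*}

/-- The product of `U` over a list of pairs of coordinates. -/
noncomputable def listProd (U : Ω → Ω → ℝ) (L : List (ι × ι)) (x : ι → Ω) : ℝ :=
  (L.map fun e => U (x e.1) (x e.2)).prod

lemma listProd_nonneg {U : Ω → Ω → ℝ} (hU : ∀ x y, 0 ≤ U x y) (L : List (ι × ι)) (x : ι → Ω) :
    0 ≤ listProd U L x :=
  List.prod_nonneg (by simp only [List.mem_map]; rintro _ ⟨e, -, rfl⟩; exact hU _ _)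

variable [MeasurableSpace Ω]

lemma BddKer.pair {U : Ω → Ω → ℝ} (hU : BddKer U) (i j : ι) :
    BddMeas fun x : ι → Ω => U (x i) (x j) :=
  BddMeas.comp hU (φ := fun x : ι → Ω => (x i, x j)) (by fun_prop)

lemma BddKer.listProd {U : Ω → Ω → ℝ} (hU : BddKer U) (L : List (ι × ι)) :
    BddMeas (listProd U L) :=
  BddMeas.list_prod L fun e _ => hU.pair e.1 e.2

variable {μ : Measure Ω} [IsProbabilityMeasure μ] [Fintype ι]

/-- Two distinct coordinates of a product measure are jointly distributed as `μ.prod μ`. -/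
lemma measurePreserving_pi_pair (μ : Measure Ω) [IsProbabilityMeasure μ] {i j : ι} (hij : i ≠ j) :
    MeasurePreserving (fun x : ι → Ω => (x i, x j)) (Measure.pi fun _ => μ) (μ.prod μ) := by
  refine ⟨by fun_prop, ?_⟩
  have h := ProbabilityTheory.iIndepFun_pi (μ := fun _ : ι => μ) (X := fun _ => (id : Ω → Ω))
    (fun _ => aemeasurable_id)
  have h2 := (ProbabilityTheory.indepFun_iff_map_prod_eq_prod_map_map
    (measurable_pi_apply i).aemeasurable (measurable_pi_apply j).aemeasurable).1 (h.indepFun hij)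
  rw [h2, (measurePreserving_eval (fun _ : ι => μ) i).map_eq,
    (measurePreserving_eval (fun _ : ι => μ) j).map_eq]

lemma integral_pi_pair {U : Ω → Ω → ℝ} (hU : BddKer U) {i j : ι} (hij : i ≠ j) :
    ∫ x : ι → Ω, U (x i) (x j) ∂(Measure.pi fun _ => μ) = ∫ x, ∫ y, U x y ∂μ ∂μ := by
  have h := measurePreserving_pi_pair (ι := ι) μ hij
  rw [← integral_prod (fun q : Ω × Ω => U q.1 q.2) (hU.integrable _), ← h.map_eq,
    integral_map h.measurable.aemeasurable hU.meas.aestronglyMeasurable]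

/-- If `P n` and `Q n` are close in `L¹`, `Q n` is bounded, and all loopless multigraph densities
of `P n` are bounded, then the multigraph densities of `P n` and `Q n` are close. -/
lemma tendsto_listProd_sub {P Q : ℕ → Ω → Ω → ℝ} {c : ℝ} (hP : ∀ n, BddKer (P n))
    (hQ : ∀ n, BddKer (Q n)) (hP0 : ∀ n x y, 0 ≤ P n x y) (hQ0 : ∀ n x y, 0 ≤ Q n x y)
    (hQc : ∀ n x y, Q n x y ≤ c)
    (hPQ : Tendsto (fun n => ∫ x, ∫ y, |P n x y - Q n x y| ∂μ ∂μ) atTop (nhds 0))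
    (hM : ∀ L : List (ι × ι), (∀ e ∈ L, e.1 ≠ e.2) →
      ∃ M : ℝ, ∀ n, ∫ x, listProd (P n) L x ∂(Measure.pi fun _ : ι => μ) ≤ M)
    (L : List (ι × ι)) (hL : ∀ e ∈ L, e.1 ≠ e.2) :
    Tendsto (fun n => ∫ x, |listProd (P n) L x - listProd (Q n) L x| ∂(Measure.pi fun _ : ι => μ))
      atTop (nhds 0) := by
  induction L with
  | nil => simp [listProd]
  | cons e L ih =>
    have hL' : ∀ f ∈ L, f.1 ≠ f.2 := fun f hf => hL f (by simp [hf])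
    specialize ih hL'
    have he : e.1 ≠ e.2 := hL e (by simp)
    obtain ⟨M₁, hM₁⟩ := hM (e :: (L ++ L)) (by
      intro f hf; simp only [List.mem_cons, List.mem_append, or_self] at hf
      rcases hf with rfl | hf
      exacts [he, hL' f hf])
    obtain ⟨M₂, hM₂⟩ := hM (L ++ L) (by
      intro f hf; simp only [List.mem_append, or_self] at hf
      exact hL' f hf)
    have hc : 0 ≤ c := by
      obtain ⟨x⟩ : Nonempty Ω := nonempty_of_isProbabilityMeasure μ
      exact (hQ0 0 x x).trans (hQc 0 x x)
    set π : Measure (ι → Ω) := Measure.pi fun _ : ι => μ with hπ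
    have key : Tendsto (fun n => ∫ x, listProd (P n) L x * |P n (x e.1) (x e.2) - Q n (x e.1) (x e.2)| ∂π)
        atTop (nhds 0) := by
      refine tendsto_zero_of_le_const_mul_add (M := M₁ + c * M₂) (fun n => integral_nonneg fun x =>
        mul_nonneg (listProd_nonneg (hP0 n) L x) (abs_nonneg _)) hPQ fun δ hδ _ => ⟨1 / δ, fun n => ?_⟩
      have hE : BddKer fun x y => |P n x y - Q n x y| := ((hP n).sub (hQ n)).abs
      have hLL := (hP n).listProd (L ++ L)
      have hLe := (hP n).listProd (e :: (L ++ L))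
      calc ∫ x, listProd (P n) L x * |P n (x e.1) (x e.2) - Q n (x e.1) (x e.2)| ∂π
          ≤ ∫ x, (1 / δ * |P n (x e.1) (x e.2) - Q n (x e.1) (x e.2)| +
              δ * (listProd (P n) (e :: (L ++ L)) x + c * listProd (P n) (L ++ L) x)) ∂π := by
            refine BddMeas.integral_mono (((hP n).listProd L).mul (hE.pair e.1 e.2))
              (((hE.pair e.1 e.2).const_mul _).add ((hLe.add (hLL.const_mul c)).const_mul δ))
              fun x => ?_
            have e1 : listProd (P n) (e :: (L ++ L)) x
                = P n (x e.1) (x e.2) * (listProd (P n) L x * listProd (P n) L x) := by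
              simp [listProd]
            have e2 : listProd (P n) (L ++ L) x = listProd (P n) L x * listProd (P n) L x := by
              simp [listProd]
            rw [e1, e2]
            have hX := listProd_nonneg (hP0 n) L x
            set X := listProd (P n) L x
            have hE' : |P n (x e.1) (x e.2) - Q n (x e.1) (x e.2)| ≤ P n (x e.1) (x e.2) + c :=
              abs_le.2 ⟨by linarith [hQc n (x e.1) (x e.2), hP0 n (x e.1) (x e.2)],
                by linarith [hQ0 n (x e.1) (x e.2)]⟩
            have hE0 := abs_nonneg (P n (x e.1) (x e.2) - Q n (x e.1) (x e.2))
            set D := |P n (x e.1) (x e.2) - Q n (x e.1) (x e.2)|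
            have h1 : X ≤ 1 / δ + δ * (X * X) := by
              have : 0 ≤ (1 - δ * X) ^ 2 + δ * X := by positivity
              have h2 : 1 / δ + δ * (X * X) - X = ((1 - δ * X) ^ 2 + δ * X) / δ := by
                field_simp; ring
              have := div_nonneg this hδ.le
              linarith
            calc X * D ≤ (1 / δ + δ * (X * X)) * D := by gcongr
              _ = 1 / δ * D + δ * (X * X) * D := by ring
              _ ≤ 1 / δ * D + δ * (X * X) * (P n (x e.1) (x e.2) + c) := by gcongr
              _ = _ := by ring
        _ = 1 / δ * (∫ x, ∫ y, |P n x y - Q n x y| ∂μ ∂μ) + δ *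
              ((∫ x, listProd (P n) (e :: (L ++ L)) x ∂π) +
                c * ∫ x, listProd (P n) (L ++ L) x ∂π) := by
            rw [BddMeas.integral_add ((hE.pair e.1 e.2).const_mul _)
              ((hLe.add (hLL.const_mul c)).const_mul δ), integral_const_mul, integral_const_mul,
              BddMeas.integral_add hLe (hLL.const_mul c), integral_const_mul,
              integral_pi_pair hE he]
        _ ≤ _ := by
            gcongr
            exacts [hM₁ n, hM₂ n]
    have hsum := (ih.const_mul c).add key
    simp only [mul_zero, add_zero] at hsum
    refine squeeze_zero (fun n => integral_nonneg fun x => abs_nonneg _) (fun n => ?_) hsum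
    have hD := (((hP n).listProd L).sub ((hQ n).listProd L)).abs
    have hE : BddKer fun x y => |P n x y - Q n x y| := ((hP n).sub (hQ n)).abs
    have hXE := ((hP n).listProd L).mul (hE.pair e.1 e.2)
    rw [← integral_const_mul, ← BddMeas.integral_add (hD.const_mul c) hXE]
    refine BddMeas.integral_mono (((hP n).listProd _).sub ((hQ n).listProd _)).abs
      ((hD.const_mul c).add hXE) fun x => ?_
    have e1 : listProd (P n) (e :: L) x - listProd (Q n) (e :: L) x
        = Q n (x e.1) (x e.2) * (listProd (P n) L x - listProd (Q n) L x) +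
          listProd (P n) L x * (P n (x e.1) (x e.2) - Q n (x e.1) (x e.2)) := by
      simp only [listProd, List.map_cons, List.prod_cons]; ring
    rw [e1]
    refine (abs_add_le _ _).trans ?_
    rw [abs_mul, abs_mul, abs_of_nonneg (hQ0 _ _ _), abs_of_nonneg (listProd_nonneg (hP0 n) L x)]
    gcongr
    exact hQc _ _ _

end Multigraph

section Coordinates

variable {Ω : Type*} [MeasurableSpace Ω] {μ : Measure Ω} [IsProbabilityMeasure μ]

lemma integral_pi_fin_succ {t : ℕ} {f : (Fin (t + 1) → Ω) → ℝ} (hf : BddMeas f) :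
    ∫ x, f x ∂(Measure.pi fun _ => μ) =
      ∫ z, ∫ y : Fin t → Ω, f (Fin.cons z y) ∂(Measure.pi fun _ => μ) ∂μ := by
  have h := (measurePreserving_piFinSuccAbove (fun _ : Fin (t + 1) => μ) 0).symm
  rw [← h.integral_comp', integral_prod]
  · simp [MeasurableEquiv.piFinSuccAbove, Fin.insertNthEquiv]
  · exact BddMeas.integrable (hf.comp h.measurable) _

lemma integral_pi_sum {ι κ : Type*} [Fintype ι] [Fintype κ] {f : (ι ⊕ κ → Ω) → ℝ}
    (hf : BddMeas f) :
    ∫ x, f x ∂(Measure.pi fun _ => μ) =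
      ∫ a : ι → Ω, ∫ b : κ → Ω, f (Sum.elim a b) ∂(Measure.pi fun _ => μ)
        ∂(Measure.pi fun _ => μ) := by
  have h := measurePreserving_sumPiEquivProdPi_symm (fun _ : ι ⊕ κ => μ)
  rw [← h.integral_comp', integral_prod]
  · rfl
  · exact BddMeas.integrable (hf.comp h.measurable) _

lemma integral_pi_curry {ι κ : Type*} [Fintype ι] [Fintype κ] (f : (ι × κ → Ω) → ℝ) :
    ∫ x, f x ∂(Measure.pi fun _ => μ) =
      ∫ y : ι → κ → Ω, f (Function.uncurry y) ∂(Measure.pi fun _ => Measure.pi fun _ => μ) := by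
  have h := Measure.infinitePi_map_curry_symm (ι := ι) (κ := κ) (fun _ _ => μ)
  simp only [Measure.infinitePi_eq_pi] at h
  rw [← h, integral_map_equiv]
  rfl

/-- The `i`-th point of the path from `a` to `b` with internal points `y`. -/
noncomputable def pathPt {X : Type*} {t : ℕ} (a b : X) (y : Fin t → X) (i : ℕ) : X :=
  if i = 0 then a else if h : i - 1 < t then y ⟨i - 1, h⟩ else b

lemma pathPt_cons_succ {X : Type*} {t : ℕ} (a b z : X) (y : Fin t → X) (i : ℕ) :
    pathPt a b (Fin.cons z y) (i + 1) = pathPt z b y i := by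
  unfold pathPt
  rcases i with _ | i
  · simp
  · simp only [Nat.add_eq_zero_iff, one_ne_zero, and_false, if_false, Nat.add_sub_cancel,
      add_lt_add_iff_right]
    split_ifs <;> rfl

lemma measurable_pathPt {X : Type*} [MeasurableSpace X] {t : ℕ} (b : X) (i : ℕ) (a : X) :
    Measurable fun y : Fin t → X => pathPt a b y i := by
  unfold pathPt
  split_ifs <;> fun_prop

lemma BddKer.pathProd {W : Ω → Ω → ℝ} (hW : BddKer W) {t : ℕ} (a b : Ω) :
    BddMeas fun y : Fin t → Ω =>
      ∏ i : Fin (t + 1), W (pathPt a b y i) (pathPt a b y (i + 1)) :=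
  BddMeas.finset_prod _ fun i _ => BddMeas.comp hW
    (φ := fun y : Fin t → Ω => (pathPt a b y i, pathPt a b y (i + 1)))
    ((measurable_pathPt b _ a).prodMk (measurable_pathPt b _ a))

lemma integral_pathProd {W : Ω → Ω → ℝ} (hW : BddKer W) (t : ℕ) (a b : Ω) :
    ∫ y : Fin t → Ω, ∏ i : Fin (t + 1), W (pathPt a b y i) (pathPt a b y (i + 1))
      ∂(Measure.pi fun _ => μ) = kpw μ W t a b := by
  induction t generalizing a with
  | zero => simp [pathPt, kpw]
  | succ t ih =>
    rw [integral_pi_fin_succ (hW.pathProd a b)]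
    change _ = ∫ z, W a z * kpw μ W t z b ∂μ
    refine integral_congr_ae (Eventually.of_forall fun z => ?_)
    dsimp only
    rw [← ih, ← integral_const_mul]
    refine integral_congr_ae (Eventually.of_forall fun y => ?_)
    dsimp only
    rw [Fin.prod_univ_succ]
    simp only [Fin.val_succ, pathPt_cons_succ, Fin.val_zero]
    simp [pathPt]

end Coordinates

section Density

variable {Ω : Type*}

/-- The product of a symmetrised kernel over the edges of a graph. -/
noncomputable def edgeProd {α : Type*} [Fintype α] (F : SimpleGraph α) (W : Ω → Ω → ℝ)
    (x : α → Ω) : ℝ :=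
  ∏ e ∈ F.edgeFinset,
      Sym2.lift ⟨fun i j => (W (x i) (x j) + W (x j) (x i)) / 2,
        fun i j => by dsimp only; rw [add_comm (W (x i) (x j)) (W (x j) (x i))]⟩ e

lemma edgeProd_eq_prod {α J : Type*} [Fintype α] [Fintype J] {F : SimpleGraph α} {W : Ω → Ω → ℝ}
    (hW : ∀ x y, W x y = W y x) (a b : J → α) (hinj : Function.Injective fun j => s(a j, b j))
    (hF : ∀ e, e ∈ F.edgeSet ↔ ∃ j, s(a j, b j) = e) (x : α → Ω) :
    edgeProd F W x = ∏ j, W (x (a j)) (x (b j)) := by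
  symm
  refine Finset.prod_nbij (fun j => s(a j, b j)) ?_ hinj.injOn ?_ ?_
  · intro j _
    exact SimpleGraph.mem_edgeFinset.2 ((hF _).2 ⟨j, rfl⟩)
  · intro e he
    obtain ⟨j, hj⟩ := (hF e).1 (SimpleGraph.mem_edgeFinset.1 he)
    exact ⟨j, by simp, hj⟩
  · intro j _
    rw [Sym2.lift_mk]
    dsimp only
    rw [hW (x (b j)) (x (a j))]
    ring

lemma edgeProd_iso {α β : Type*} [Fintype α] [Fintype β] {F : SimpleGraph α}
    {H : SimpleGraph β} (φ : F ≃g H) {W : Ω → Ω → ℝ} {x : α → Ω} {y : β → Ω}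
    (h : ∀ i, y (φ i) = x i) : edgeProd F W x = edgeProd H W y := by
  refine Finset.prod_nbij (Sym2.map φ) ?_ (Sym2.map.injective φ.injective).injOn ?_ ?_
  · intro e he
    induction e using Sym2.ind with
    | _ a b => simpa [φ.map_adj_iff] using he
  · intro e he
    induction e using Sym2.ind with
    | _ a b => exact ⟨s(φ.symm a, φ.symm b), by simpa [φ.symm.map_adj_iff] using he, by simp⟩
  · intro e _
    induction e using Sym2.ind with
    | _ a b => simp [h]

variable [MeasurableSpace Ω]

/-- The density of a finite graph in a kernel. -/
noncomputable def graphDensity {α : Type*} [Fintype α] (μ : Measure Ω) (F : SimpleGraph α)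
    (W : Ω → Ω → ℝ) : ℝ :=
  ∫ x, edgeProd F W x ∂(Measure.pi fun _ : α => μ)

lemma homDensity_eq {α : Type*} [Fintype α] (F : SimpleGraph α) (κ : ℝ → ℝ → ℝ) :
    homDensity F κ = graphDensity (volume.restrict (Icc 0 1)) F κ := by
  unfold homDensity graphDensity
  rw [volume_pi, Measure.restrict_pi_pi]
  rfl

lemma pv_eq {Ω : Type*} {t k m : ℕ} (u v : Fin m → Fin k) (r : Fin m) (i : ℕ)
    (a : Fin k → Ω) (b : Fin m × Fin (t + 1 - 1) → Ω) :
    Sum.elim a b (pv (t + 1) u v r i) =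
      pathPt (t := t) (a (u r)) (a (v r)) (fun j => b (r, j)) i := by
  unfold pv pathPt
  rcases i with _ | i
  · simp
  · simp only [Nat.add_eq_zero_iff, one_ne_zero, and_false, dite_false, if_false,
      Nat.add_sub_cancel, add_lt_add_iff_right]
    split_ifs <;> rfl

lemma pv_edge_injective {t k m : ℕ} (ht : 1 ≤ t) {u v : Fin m → Fin k} (huv : ∀ r, u r ≠ v r) :
    Function.Injective fun q : Fin m × Fin (t + 1) =>
      s(pv (t + 1) u v q.1 q.2, pv (t + 1) u v q.1 (q.2 + 1)) := by
  rintro ⟨r, i⟩ ⟨r', i'⟩ h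
  simp only [Sym2.eq_iff, pv] at h
  rw [Prod.ext_iff, Fin.ext_iff]
  have := i.2
  have := i'.2
  have := huv r
  split_ifs at h <;> simp [Prod.ext_iff, Fin.ext_iff] at h ⊢ <;> grind

lemma mem_edgeSet_multiSubdiv {t k m : ℕ} (ht : 1 ≤ t) {u v : Fin m → Fin k}
    (e : Sym2 (Fin k ⊕ (Fin m × Fin t))) :
    e ∈ (multiSubdiv (t + 1) u v).edgeSet ↔ ∃ q : Fin m × Fin (t + 1),
      s(pv (t + 1) u v q.1 q.2, pv (t + 1) u v q.1 (q.2 + 1)) = e := by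
  induction e using Sym2.ind with
  | _ x y =>
    have hne : ∀ r i, i < t + 1 → pv (t + 1) u v r i ≠ pv (t + 1) u v r (i + 1) := by
      intro r i hi
      unfold pv
      split_ifs <;> simp <;> omega
    rw [SimpleGraph.mem_edgeSet]
    unfold multiSubdiv
    rw [SimpleGraph.fromRel_adj]
    constructor
    · rintro ⟨-, ⟨r, i, hi, rfl, rfl⟩ | ⟨r, i, hi, rfl, rfl⟩⟩
      · exact ⟨(r, ⟨i, hi⟩), rfl⟩
      · exact ⟨(r, ⟨i, hi⟩), Sym2.eq_swap⟩
    · rintro ⟨⟨r, i⟩, h⟩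
      rcases Sym2.eq_iff.1 h with ⟨rfl, rfl⟩ | ⟨rfl, rfl⟩
      · exact ⟨hne r i i.2, Or.inl ⟨r, i, i.2, rfl, rfl⟩⟩
      · exact ⟨(hne r i i.2).symm, Or.inr ⟨r, i, i.2, rfl, rfl⟩⟩

variable {μ : Measure Ω} [IsProbabilityMeasure μ]

lemma graphDensity_multiSubdiv {t k m : ℕ} (ht : 1 ≤ t) {u v : Fin m → Fin k}
    (huv : ∀ r, u r ≠ v r) {W : Ω → Ω → ℝ} (hW : BddKer W) (hsymm : ∀ x y, W x y = W y x) :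
    graphDensity μ (multiSubdiv (t + 1) u v) W =
      ∫ x : Fin k → Ω, ∏ r, kpw μ W t (x (u r)) (x (v r)) ∂(Measure.pi fun _ => μ) := by
  unfold graphDensity
  have hE := edgeProd_eq_prod hsymm _ _ (pv_edge_injective ht huv)
    (mem_edgeSet_multiSubdiv ht)
  simp only [hE]
  rw [integral_pi_sum (BddMeas.finset_prod _ fun q _ => hW.pair _ _)]
  refine integral_congr_ae (Eventually.of_forall fun a => ?_)
  dsimp only
  rw [integral_pi_curry]
  simp only [pv_eq, Function.uncurry_apply_pair, Fintype.prod_prod_type]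
  refine (integral_fintype_prod_eq_prod (fun r (y : Fin t → Ω) => ∏ i : Fin (t + 1),
    W (pathPt (a (u r)) (a (v r)) y i) (pathPt (a (u r)) (a (v r)) y (i + 1)))).trans ?_
  exact Finset.prod_congr rfl fun r _ => integral_pathProd hW t _ _

lemma graphDensity_iso {α β : Type*} [Fintype α] [Fintype β] {F : SimpleGraph α}
    {H : SimpleGraph β} (φ : F ≃g H) (W : Ω → Ω → ℝ) :
    graphDensity μ F W = graphDensity μ H W := by
  unfold graphDensity
  have h := measurePreserving_piCongrLeft (fun _ : β => μ) φ.toEquiv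
  rw [← h.integral_comp']
  refine integral_congr_ae (Eventually.of_forall fun x => edgeProd_iso φ fun i => ?_)
  exact Equiv.piCongrLeft_apply_apply (fun _ : β => Ω) φ.toEquiv x i

lemma graphDensity_starGraph {W : Ω → Ω → ℝ} (hW : BddKer W) (hsymm : ∀ x y, W x y = W y x)
    (k : ℕ) :
    graphDensity μ (SimpleGraph.starGraph (0 : Fin (k + 1))) W = ∫ x, (∫ y, W x y ∂μ) ^ k ∂μ := by
  unfold graphDensity
  have hE := edgeProd_eq_prod (F := SimpleGraph.starGraph (0 : Fin (k + 1))) hsymm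
    (fun _ : Fin k => 0) (fun j : Fin k => j.succ) ?_ ?_
  · simp only [hE]
    rw [integral_pi_fin_succ (BddMeas.finset_prod _ fun q _ => hW.pair _ _)]
    refine integral_congr_ae (Eventually.of_forall fun a => ?_)
    simp only [Fin.cons_zero, Fin.cons_succ]
    rw [integral_fintype_prod_eq_pow (fun y => W a y), Fintype.card_fin]
  · intro i j h
    simpa [Fin.ext_iff] using h
  · intro e
    induction e using Sym2.ind with
    | _ x y =>
      rw [SimpleGraph.mem_edgeSet, SimpleGraph.starGraph_adj]
      constructor
      · rintro ⟨hne, rfl | rfl⟩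
        · obtain ⟨j, rfl⟩ := Fin.exists_succ_eq.2 hne.symm
          exact ⟨j, rfl⟩
        · obtain ⟨j, rfl⟩ := Fin.exists_succ_eq.2 hne
          exact ⟨j, Sym2.eq_swap⟩
      · rintro ⟨j, h⟩
        rcases Sym2.eq_iff.1 h with ⟨rfl, rfl⟩ | ⟨rfl, rfl⟩
        · exact ⟨(Fin.succ_ne_zero j).symm, Or.inl rfl⟩
        · exact ⟨Fin.succ_ne_zero j, Or.inr rfl⟩

end Density

section GraphKernel

/-- The kernel `1 / p` on the edges of `G`. -/
noncomputable def adjKer {N : ℕ} (p : ℝ) (G : SimpleGraph (Fin N)) (i j : Fin N) : ℝ :=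
  if G.Adj i j then 1 / p else 0

/-- The vertex whose interval contains `x`. -/
noncomputable def cell (n : ℕ) (x : ℝ) : Fin (n + 1) := ⟨min (idx (n + 1) x) n, by omega⟩

/-- A version of `graphKernel` that is a step function on the whole plane. -/
noncomputable def stepKer {n : ℕ} (p : ℝ) (G : SimpleGraph (Fin (n + 1))) (x y : ℝ) : ℝ :=
  adjKer p G (cell n x) (cell n y)

lemma measurable_cell (n : ℕ) : Measurable (cell n) := by
  have h : Measurable fun x : ℝ => min (idx (n + 1) x) n := by
    unfold idx
    have : Measurable fun x : ℝ => ⌈x * (n + 1 : ℕ)⌉₊ :=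
      Nat.measurable_ceil.comp (measurable_id.mul_const _)
    exact ((measurable_from_top (f := fun k : ℕ => min (k - 1) n)).comp this)
  refine measurable_to_countable' fun i => ?_
  have : cell n ⁻¹' {i} = (fun x : ℝ => min (idx (n + 1) x) n) ⁻¹' {(i : ℕ)} := by
    ext x
    simp [cell, Fin.ext_iff]
  rw [this]
  exact h (measurableSet_singleton _)

lemma idx_lt {n : ℕ} {x : ℝ} (hx : x ∈ Ioc (0 : ℝ) 1) : idx (n + 1) x < n + 1 := by
  unfold idx
  have : ⌈x * (n + 1 : ℕ)⌉₊ ≤ n + 1 := Nat.ceil_le.2 <|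
    mul_le_of_le_one_left (Nat.cast_nonneg _) hx.2
  omega

lemma graphKernel_eq_stepKer {n : ℕ} (p : ℝ) (G : SimpleGraph (Fin (n + 1))) {x y : ℝ}
    (hx : x ∈ Ioc (0 : ℝ) 1) (hy : y ∈ Ioc (0 : ℝ) 1) :
    graphKernel p G x y = stepKer p G x y := by
  have h1 := idx_lt (n := n) hx
  have h2 := idx_lt (n := n) hy
  have e1 : cell n x = ⟨idx (n + 1) x, h1⟩ := Fin.ext (min_eq_left (by omega))
  have e2 : cell n y = ⟨idx (n + 1) y, h2⟩ := Fin.ext (min_eq_left (by omega))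
  unfold graphKernel stepKer adjKer
  rw [dif_pos ⟨hx, hy, h1, h2⟩, e1, e2]

lemma cell_preimage_inter (n : ℕ) (i : Fin (n + 1)) :
    cell n ⁻¹' {i} ∩ Ioc 0 1 = Ioc ((i : ℝ) / (n + 1)) ((i + 1) / (n + 1)) := by
  have hn : (0 : ℝ) < n + 1 := by positivity
  have hi : (i : ℝ) + 1 ≤ n + 1 := by exact_mod_cast i.2
  ext x
  have key : x ∈ Ioc (0 : ℝ) 1 → (cell n x = i ↔ ⌈x * (n + 1)⌉₊ = i + 1) := by
    intro hx
    have h1 := idx_lt (n := n) hx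
    have h2 : 0 < ⌈x * (n + 1)⌉₊ := Nat.ceil_pos.2 (mul_pos hx.1 hn)
    unfold idx at h1
    push_cast at h1
    simp only [cell, idx, Fin.ext_iff]
    push_cast
    omega
  have key2 : ⌈x * (n + 1)⌉₊ = (i : ℕ) + 1 ↔ x ∈ Ioc ((i : ℝ) / (n + 1)) ((i + 1) / (n + 1)) := by
    rw [Nat.ceil_eq_iff (by omega), mem_Ioc, div_lt_iff₀ hn, le_div_iff₀ hn]
    push_cast
    simp
  simp only [mem_inter_iff, mem_preimage, mem_singleton_iff]
  constructor
  · rintro ⟨h, hx⟩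
    exact key2.1 ((key hx).1 h)
  · intro h
    have hx : x ∈ Ioc (0 : ℝ) 1 :=
      ⟨lt_of_le_of_lt (by positivity) h.1, h.2.trans ((div_le_one hn).2 hi)⟩
    exact ⟨(key hx).2 (key2.2 h), hx⟩

instance isProbabilityMeasure_restrict_Icc :
    IsProbabilityMeasure (volume.restrict (Icc (0 : ℝ) 1)) := ⟨by simp⟩

lemma map_cell_singleton (n : ℕ) (i : Fin (n + 1)) :
    ((volume.restrict (Icc (0 : ℝ) 1)).map (cell n)).real {i} = 1 / (n + 1) := by
  have hn : (0 : ℝ) < n + 1 := by positivity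
  rw [map_measureReal_apply (measurable_cell n) (measurableSet_singleton _),
    ← Measure.restrict_congr_set (Ioc_ae_eq_Icc (μ := volume) (a := (0 : ℝ)) (b := 1)),
    measureReal_restrict_apply (measurable_cell n (measurableSet_singleton _)),
    cell_preimage_inter, Real.volume_real_Ioc_of_le (by gcongr; linarith)]
  field_simp
  ring

lemma BddKer.stepKer {n : ℕ} (p : ℝ) (G : SimpleGraph (Fin (n + 1))) : BddKer (stepKer p G) := by
  refine ⟨?_, |1 / p|, fun q => ?_⟩
  · exact (measurable_of_finite fun q : Fin (n + 1) × Fin (n + 1) => adjKer p G q.1 q.2).comp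
      (((measurable_cell n).comp measurable_fst).prodMk ((measurable_cell n).comp measurable_snd))
  · unfold _root_.stepKer adjKer
    split_ifs
    · exact le_rfl
    · simp

lemma edgeProd_adjKer {α : Type*} [Fintype α] (F : SimpleGraph α) {N : ℕ} (p : ℝ)
    (G : SimpleGraph (Fin N)) (y : α → Fin N) :
    edgeProd F (adjKer p G) y = if IsHom F G y then (1 / p) ^ edgeCount F else 0 := by
  unfold edgeProd
  split_ifs with h
  · rw [edgeCount, Nat.card_eq_fintype_card, ← SimpleGraph.edgeFinset_card, ← Finset.prod_const]
    refine Finset.prod_congr rfl fun e he => ?_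
    induction e using Sym2.ind with
    | _ a b =>
      have := h a b (by simpa using he)
      simp [adjKer, this, this.symm]
  · simp only [IsHom, not_forall] at h
    obtain ⟨a, b, hab, hn⟩ := h
    refine Finset.prod_eq_zero (i := s(a, b)) (by simpa using hab) ?_
    have : ¬ G.Adj (y b) (y a) := fun h' => hn h'.symm
    simp [adjKer, hn, this]

lemma tDen_eq_graphDensity {α : Type*} [Fintype α] (F : SimpleGraph α) {n : ℕ} (p : ℝ)
    (G : SimpleGraph (Fin (n + 1))) :
    tDen p F G = graphDensity (volume.restrict (Icc (0 : ℝ) 1)) F (stepKer p G) := by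
  set μ := volume.restrict (Icc (0 : ℝ) 1) with hμ
  have hc : MeasurePreserving (cell n) μ (μ.map (cell n)) := ⟨measurable_cell n, rfl⟩
  have : IsProbabilityMeasure (μ.map (cell n)) :=
    Measure.isProbabilityMeasure_map (measurable_cell n).aemeasurable
  have hpi := measurePreserving_pi (fun _ : α => μ) (fun _ => μ.map (cell n)) fun _ => hc
  have h1 : graphDensity μ F (stepKer p G) =
      ∫ y, edgeProd F (adjKer p G) y ∂(Measure.pi fun _ : α => μ.map (cell n)) := by
    rw [← hpi.map_eq, integral_map hpi.measurable.aemeasurable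
      (measurable_of_finite _).aestronglyMeasurable]
    rfl
  rw [h1, integral_fintype (.of_finite)]
  have h2 : ∀ y : α → Fin (n + 1), (Measure.pi fun _ : α => μ.map (cell n)).real {y} =
      (1 / (n + 1)) ^ Fintype.card α := by
    intro y
    rw [measureReal_def, Measure.pi_singleton, ENNReal.toReal_prod]
    have : ∀ i, ((μ.map (cell n)) {y i}).toReal = 1 / (n + 1) := fun i => map_cell_singleton n (y i)
    simp [this]
  have h3 : homCount F G = (Finset.univ.filter fun y : α → Fin (n + 1) => IsHom F G y).card := by
    rw [homCount, ← Fintype.card_subtype, ← Nat.card_eq_fintype_card]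
    exact Nat.card_congr ⟨fun φ => ⟨φ, fun _ _ h => φ.map_adj h⟩, fun y => ⟨y.1, y.2 _ _⟩,
      fun _ => rfl, fun _ => rfl⟩
  simp only [h2, edgeProd_adjKer, smul_eq_mul]
  rw [← Finset.mul_sum, ← Finset.sum_filter, Finset.sum_const, nsmul_eq_mul, ← h3, tDen,
    Fintype.card_fin]
  push_cast
  simp only [one_div, inv_pow]
  rw [div_eq_mul_inv, mul_inv]
  ring

end GraphKernel

section Cycle

variable {Ω : Type*} [MeasurableSpace Ω] {μ : Measure Ω}

lemma kpw_add [IsFiniteMeasure μ] {W : Ω → Ω → ℝ} (hW : BddKer W) (s t : ℕ) :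
    kpw μ W (s + t + 1) = kcomp μ (kpw μ W s) (kpw μ W t) := by
  induction s with
  | zero => rw [zero_add]; rfl
  | succ s ih =>
    calc kpw μ W (s + 1 + t + 1) = kcomp μ W (kpw μ W (s + t + 1)) := by
          rw [Nat.add_right_comm s 1 t]; rfl
      _ = _ := by rw [ih, ← kcomp_assoc hW (hW.kpw s) (hW.kpw t)]; rfl

lemma kpw_symm [IsFiniteMeasure μ] {W : Ω → Ω → ℝ} (hW : BddKer W)
    (hsymm : ∀ x y, W x y = W y x) (t : ℕ) (x y : Ω) : kpw μ W t x y = kpw μ W t y x := by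
  induction t generalizing x y with
  | zero => exact hsymm x y
  | succ t ih =>
    refine (congrFun₂ (kpw_succ_right hW t) x y).trans ?_
    change ∫ z, kpw μ W t x z * W z y ∂μ = ∫ z, W y z * kpw μ W t z x ∂μ
    simp only [ih x, hsymm y, mul_comm]

variable [IsProbabilityMeasure μ] {W : Ω → Ω → ℝ}

lemma graphDensity_cycleGraph (hW : BddKer W) (hsymm : ∀ x y, W x y = W y x) {N : ℕ}
    (hN : 2 ≤ N) :
    graphDensity μ (SimpleGraph.cycleGraph (N + 1)) W = ∫ z, kpw μ W N z z ∂μ := by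
  obtain ⟨N, rfl⟩ : ∃ K, N = K + 1 := ⟨N - 1, by omega⟩
  unfold graphDensity
  have hE := edgeProd_eq_prod (F := SimpleGraph.cycleGraph (N + 1 + 1)) hsymm
    (fun j : Fin (N + 1 + 1) => j) (fun j => j + 1) ?_ ?_
  · simp only [hE]
    rw [integral_pi_fin_succ (BddMeas.finset_prod _ fun q _ => hW.pair _ _)]
    refine integral_congr_ae (Eventually.of_forall fun z => ?_)
    dsimp only
    rw [← integral_pathProd hW]
    refine integral_congr_ae (Eventually.of_forall fun y => ?_)
    have h0 : ∀ j : Fin (N + 1 + 1), (Fin.cons z y : Fin (N + 1 + 1) → Ω) j = pathPt z z y j := by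
      intro j
      induction j using Fin.cases with
      | zero => simp [pathPt]
      | succ j => simp [pathPt, j.2]
    have h1 : ∀ j : Fin (N + 1 + 1),
        (Fin.cons z y : Fin (N + 1 + 1) → Ω) (j + 1) = pathPt z z y (j + 1) := by
      intro j
      rw [h0]
      induction j using Fin.lastCases with
      | last => simp [pathPt]
      | cast j => simp
    simp only [h1]
    simp only [h0]
  · intro i j h
    rcases Sym2.eq_iff.1 h with ⟨h, -⟩ | ⟨h, h'⟩
    · exact h
    · exfalso
      subst h
      have h2 : (1 : Fin (N + 1 + 1)) + 1 = 0 := by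
        have : j + ((1 : Fin (N + 1 + 1)) + 1) = j + 0 := by rw [← add_assoc, add_zero]; exact h'
        exact add_left_cancel this
      have h3 := congrArg Fin.val h2
      rw [Fin.val_add, Fin.val_one, Fin.val_zero, Nat.mod_eq_of_lt (by omega)] at h3
      omega
  · intro e
    induction e using Sym2.ind with
    | _ x y =>
      rw [SimpleGraph.mem_edgeSet, SimpleGraph.cycleGraph_adj]
      constructor
      · rintro (h | h)
        · exact ⟨y, by rw [← h]; simp⟩
        · exact ⟨x, by rw [← h]; simp⟩
      · rintro ⟨j, h⟩
        rcases Sym2.eq_iff.1 h with ⟨rfl, rfl⟩ | ⟨rfl, rfl⟩ <;> simp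

lemma graphDensity_cycleGraph_even (hW : BddKer W) (hsymm : ∀ x y, W x y = W y x) {s : ℕ}
    (hs : 1 ≤ s) :
    graphDensity μ (SimpleGraph.cycleGraph (s + s + 1 + 1)) W =
      ∫ x, ∫ y, kpw μ W s x y ^ 2 ∂μ ∂μ := by
  rw [graphDensity_cycleGraph hW hsymm (by omega), kpw_add hW]
  simp only [kcomp]
  congr! 4 with x y
  rw [kpw_symm hW hsymm s y x, sq]

end Cycle

section Pullback

lemma BddKer.edgeProd {Ω α : Type*} [MeasurableSpace Ω] [Fintype α] {W : Ω → Ω → ℝ}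
    (hW : BddKer W) (F : SimpleGraph α) : BddMeas (edgeProd F W) := by
  refine BddMeas.finset_prod _ fun e _ => ?_
  induction e using Sym2.ind with
  | _ i j =>
    simp only [Sym2.lift_mk, div_eq_inv_mul]
    exact ((hW.pair i j).add (hW.pair j i)).const_mul _

lemma graphDensity_comp {Ω α : Type*} [MeasurableSpace Ω] [Fintype α] {μ : Measure Ω}
    [IsProbabilityMeasure μ] {W : Ω → Ω → ℝ} (hW : BddKer W) (F : SimpleGraph α) {τ : Ω → Ω}
    (hτ : MeasurePreserving τ μ μ) :
    graphDensity μ F (fun x y => W (τ x) (τ y)) = graphDensity μ F W := by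
  have hpi := measurePreserving_pi (fun _ : α => μ) (fun _ => μ) fun _ => hτ
  unfold graphDensity
  conv_rhs => rw [← hpi.map_eq]
  rw [integral_map hpi.measurable.aemeasurable (hW.edgeProd F).meas.aestronglyMeasurable]
  rfl

end Pullback

section Cut

lemma abs_setIntegral_le_cutNorm {W : ℝ → ℝ → ℝ} {c : ℝ} (hc : ∀ x y, |W x y| ≤ c) {S T : Set ℝ}
    (hS : MeasurableSet S) (hT : MeasurableSet T) (hSI : S ⊆ Icc 0 1) (hTI : T ⊆ Icc 0 1) :
    |∫ q in S ×ˢ T, W q.1 q.2| ≤ cutNorm W := by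
  refine le_csSup ⟨c, ?_⟩ ⟨S, T, hS, hT, hSI, hTI, rfl⟩
  rintro _ ⟨S, T, -, -, hS, hT, rfl⟩
  have hI : volume (Icc (0 : ℝ) 1 ×ˢ Icc (0 : ℝ) 1) = 1 := by
    rw [Measure.volume_eq_prod, Measure.prod_prod]
    simp
  have hv : volume (S ×ˢ T) ≤ 1 := hI ▸ measure_mono (prod_mono hS hT)
  have hv' : volume.real (S ×ˢ T) ≤ 1 := ENNReal.toReal_le_of_le_ofReal zero_le_one (by simpa using hv)
  have h0 : 0 ≤ c := (abs_nonneg _).trans (hc 0 0)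
  calc |∫ q in S ×ˢ T, W q.1 q.2| ≤ c * volume.real (S ×ˢ T) :=
        norm_setIntegral_le_of_norm_le_const (f := fun q : ℝ × ℝ => W q.1 q.2) (hv.trans_lt ENNReal.one_lt_top)
          fun q _ => hc q.1 q.2
    _ ≤ c := mul_le_of_le_one_right h0 hv'

lemma exists_mpBij_cutNorm_lt (κ₁ κ₂ : ℝ → ℝ → ℝ) {δ : ℝ} (hδ : 0 < δ) :
    ∃ τ, MPBij τ ∧ cutNorm (fun x y => κ₁ x y - κ₂ (τ x) (τ y)) < cutDist κ₁ κ₂ + δ := by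
  obtain ⟨_, ⟨τ, hτ, rfl⟩, hlt⟩ := exists_lt_of_csInf_lt
    (s := {r | ∃ τ : ℝ → ℝ, MPBij τ ∧ r = cutNorm (fun x y => κ₁ x y - κ₂ (τ x) (τ y))})
    ⟨_, id, ⟨MeasurePreserving.id _, bijOn_id _⟩, rfl⟩ (lt_add_of_pos_right _ hδ)
  exact ⟨τ, hτ, hlt⟩

lemma abs_integral_stepKer_sub_le {n : ℕ} (p : ℝ) (G : SimpleGraph (Fin (n + 1)))
    {B : ℝ → ℝ → ℝ} (hB : BddKer B) {S T : Set ℝ} (hS : MeasurableSet S) (hT : MeasurableSet T) :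
    |∫ x in S, ∫ y in T, (stepKer p G x y - B x y) ∂(volume.restrict (Icc 0 1))
      ∂(volume.restrict (Icc 0 1))| ≤ cutNorm (fun x y => graphKernel p G x y - B x y) := by
  have hr : ∀ {S : Set ℝ}, MeasurableSet S →
      (volume.restrict (Icc (0 : ℝ) 1)).restrict S = volume.restrict (S ∩ Ioc 0 1) := by
    intro S hS
    rw [Measure.restrict_restrict hS]
    exact Measure.restrict_congr_set ((ae_eq_refl S).inter Ioc_ae_eq_Icc.symm)
  have hfin : ∀ S : Set ℝ, IsFiniteMeasure (volume.restrict (S ∩ Ioc 0 1)) := fun S =>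
    ⟨by rw [Measure.restrict_apply_univ]; exact (measure_mono inter_subset_right).trans_lt (by simp)⟩
  rw [hr hS, hr hT]
  have hD : BddKer fun x y => stepKer p G x y - B x y := (BddKer.stepKer p G).sub hB
  have := hfin S
  have := hfin T
  have hI : IntegrableOn (fun q : ℝ × ℝ => stepKer p G q.1 q.2 - B q.1 q.2)
      ((S ∩ Ioc 0 1) ×ˢ (T ∩ Ioc 0 1)) (volume.prod volume) := by
    rw [IntegrableOn, ← Measure.prod_restrict]
    exact hD.integrable _
  rw [← setIntegral_prod _ hI, ← Measure.volume_eq_prod]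
  have hS' := hS.inter (measurableSet_Ioc (a := (0 : ℝ)) (b := 1))
  have hT' := hT.inter (measurableSet_Ioc (a := (0 : ℝ)) (b := 1))
  have hcongr : ∫ q in (S ∩ Ioc 0 1) ×ˢ (T ∩ Ioc 0 1), (stepKer p G q.1 q.2 - B q.1 q.2) =
      ∫ q in (S ∩ Ioc 0 1) ×ˢ (T ∩ Ioc 0 1), (graphKernel p G q.1 q.2 - B q.1 q.2) := by
    refine setIntegral_congr_fun (hS'.prod hT') fun q hq => ?_
    rw [graphKernel_eq_stepKer p G hq.1.2 hq.2.2]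
  obtain ⟨b, hb⟩ := hB.bdd
  rw [hcongr]
  refine abs_setIntegral_le_cutNorm (W := fun x y => graphKernel p G x y - B x y)
    (c := |1 / p| + b) (fun x y => ?_) hS' hT'
    (inter_subset_right.trans Ioc_subset_Icc_self) (inter_subset_right.trans Ioc_subset_Icc_self)
  refine (abs_sub _ _).trans (add_le_add ?_ (hb (x, y)))
  unfold graphKernel
  split_ifs <;> simp

end Cut

section Main

variable {p : ℕ → ℝ} {G : ∀ n, SimpleGraph (Fin n)}

lemma stepKer_nonneg {n : ℕ} {p : ℝ} (hp : 0 ≤ p) (G : SimpleGraph (Fin (n + 1))) (x y : ℝ) :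
    0 ≤ stepKer p G x y := by
  unfold stepKer adjKer
  split_ifs
  exacts [by positivity, le_rfl]

lemma stepKer_symm {n : ℕ} (p : ℝ) (G : SimpleGraph (Fin (n + 1))) (x y : ℝ) :
    stepKer p G x y = stepKer p G y x := by
  simp only [stepKer, adjKer, G.adj_comm]

/-- Bounded tree densities give bounded moments of the degrees. -/
lemma momBdd_stepKer (hp : ∀ n, p n ∈ Ioc (0 : ℝ) 1)
    (htree : ∀ (m : ℕ) (T : SimpleGraph (Fin m)), T.IsTree →
      ∃ M : ℝ, ∀ n, tDen (p n) T (G n) ≤ M) :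
    MomBdd (volume.restrict (Icc (0 : ℝ) 1)) fun n x =>
      ∫ y, stepKer (p (n + 1)) (G (n + 1)) x y ∂(volume.restrict (Icc (0 : ℝ) 1)) where
  bm n := BddMeas.integral (BddKer.stepKer (p (n + 1)) (G (n + 1))) _
  nonneg n x := integral_nonneg fun y => stepKer_nonneg (hp _).1.le _ x y
  mom k := by
    obtain ⟨M, hM⟩ := htree (k + 1) _ (SimpleGraph.isTree_starGraph 0)
    refine ⟨M, fun n => ?_⟩
    have h := hM (n + 1)
    rwa [tDen_eq_graphDensity,
      graphDensity_starGraph (BddKer.stepKer _ _) (stepKer_symm _ _)] at h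

lemma listProd_ofFn {Ω : Type*} {k m : ℕ} (U : Ω → Ω → ℝ) (u v : Fin m → Fin k) (x : Fin k → Ω) :
    listProd U (List.ofFn fun r => (u r, v r)) x = ∏ r, U (x (u r)) (x (v r)) := by
  simp [listProd, List.map_ofFn, List.prod_ofFn]

/-- Bounded densities of subdivisions give bounded multigraph densities of kernel powers. -/
lemma exists_integral_listProd_le {t : ℕ} (ht : 1 ≤ t)
    (hFam : ∀ (N : ℕ) (F : SimpleGraph (Fin N)), InFamilyF (t + 1) F →
      ∃ M : ℝ, ∀ n, tDen (p n) F (G n) ≤ M) {k : ℕ} (hk : 1 ≤ k)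
    (L : List (Fin k × Fin k)) (hL : ∀ e ∈ L, e.1 ≠ e.2) :
    ∃ M : ℝ, ∀ n, ∫ x, listProd (kpw (volume.restrict (Icc (0 : ℝ) 1))
      (stepKer (p (n + 1)) (G (n + 1))) t) L x
        ∂(Measure.pi fun _ : Fin k => volume.restrict (Icc (0 : ℝ) 1)) ≤ M := by
  set u : Fin L.length → Fin k := fun r => (L[r.1]).1 with hu
  set v : Fin L.length → Fin k := fun r => (L[r.1]).2 with hv
  have huv : ∀ r, u r ≠ v r := fun r => hL _ (List.getElem_mem _)
  have hLuv : L = List.ofFn fun r => (u r, v r) := by simp [hu, hv]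
  have φ := (multiSubdiv (t + 1) u v).overFinIso rfl
  obtain ⟨M, hM⟩ := hFam _ _ ⟨k, L.length, u, v, hk, huv, ⟨φ.symm⟩⟩
  refine ⟨M, fun n => ?_⟩
  have h := hM (n + 1)
  rw [tDen_eq_graphDensity, ← graphDensity_iso φ,
    graphDensity_multiSubdiv ht huv (BddKer.stepKer _ _) (stepKer_symm _ _)] at h
  simp_rw [← listProd_ofFn, ← hLuv] at h
  exact h

end Main

/-- Sparse counting lemma (homomorphism version) for graphs in `F_ℓ`. -/
theorem sparse_homomorphism_counting (C : ℝ) (hC : 0 < C) (ℓ : ℕ) (hℓ : 3 ≤ ℓ)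
    (p : ℕ → ℝ) (hp : ∀ n, p n ∈ Ioc (0:ℝ) 1)
    (G : ∀ n, SimpleGraph (Fin n))
    (htree : ∀ (m : ℕ) (T : SimpleGraph (Fin m)), T.IsTree →
      ∃ M : ℝ, ∀ n, tDen (p n) T (G n) ≤ M)
    (hFam : ∀ (N : ℕ) (F : SimpleGraph (Fin N)), InFamilyF ℓ F →
      ∃ M : ℝ, ∀ n, tDen (p n) F (G n) ≤ M)
    (hcycle : ∃ M : ℝ, ∀ n, tDen (p n) (SimpleGraph.cycleGraph (2 * ℓ - 2)) (G n) ≤ M)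
    (κ : ℝ → ℝ → ℝ) (hκ : IsKernelBdd κ C)
    (hconv : Tendsto (fun n => cutDist (graphKernel (p n) (G n)) κ) atTop (nhds 0)) :
    ∀ (N : ℕ) (F : SimpleGraph (Fin N)), InFamilyF ℓ F →
      Tendsto (fun n => tDen (p n) F (G n)) atTop (nhds (homDensity F κ)) := by
  intro N F hF
  obtain ⟨s, rfl⟩ : ∃ s, ℓ = s + 1 + 1 := ⟨ℓ - 2, by omega⟩
  obtain ⟨k, m, u, v, hk, huv, ⟨φ⟩⟩ := hF
  set μ := volume.restrict (Icc (0 : ℝ) 1) with hμ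
  obtain ⟨hκm, hκs, hκC⟩ := hκ
  have hκb : BddKer κ := ⟨hκm, C, fun q => abs_le.2
    ⟨by linarith [(hκC q.1 q.2).1], (hκC q.1 q.2).2⟩⟩
  choose τ hτ hcut using fun n : ℕ =>
    exists_mpBij_cutNorm_lt (graphKernel (p (n + 1)) (G (n + 1))) κ
      (Nat.one_div_pos_of_nat (α := ℝ) (n := n))
  set A : ℕ → ℝ → ℝ → ℝ := fun n => stepKer (p (n + 1)) (G (n + 1)) with hA
  set B : ℕ → ℝ → ℝ → ℝ := fun n x y => κ (τ n x) (τ n y) with hB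
  have hBb : ∀ n, BddKer (B n) := fun n => hκb.comp (φ := fun q : ℝ × ℝ => (τ n q.1, τ n q.2))
    (((hτ n).1.measurable.comp measurable_fst).prodMk ((hτ n).1.measurable.comp measurable_snd))
  have hclose : CutClose μ A B C
      fun n => cutDist (graphKernel (p (n + 1)) (G (n + 1))) κ + 1 / ((n : ℝ) + 1) :=
    { bmA := fun n => BddKer.stepKer _ _
      bmB := hBb
      nonnegA := fun n => stepKer_nonneg (hp _).1.le _
      nonnegB := fun n x y => (hκC _ _).1
      leB := fun n x y => (hκC _ _).2
      symmA := fun n => stepKer_symm _ _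
      symmB := fun n x y => hκs _ _
      deg := momBdd_stepKer hp htree
      cut := fun n S T hS hT =>
        (abs_integral_stepKer_sub_le _ _ (hBb n) hS hT).trans (hcut n).le
      lim := by
        simpa using ((tendsto_add_atTop_iff_nat 1).2 hconv).add
          (tendsto_one_div_add_atTop_nhds_zero_nat (𝕜 := ℝ)) }
  obtain ⟨M, hM⟩ := hcycle
  rw [show 2 * (s + 1 + 1) - 2 = s + s + 1 + 1 by omega] at hM
  have hL1 := hclose.tendsto_kpw_sub s (M := M) fun n => by
    have h := hM (n + 1)
    rwa [tDen_eq_graphDensity, graphDensity_cycleGraph_even (BddKer.stepKer _ _)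
      (stepKer_symm _ _) (by omega)] at h
  have hlist := tendsto_listProd_sub (fun n => (hclose.bmA n).kpw (s + 1))
    (fun n => (hBb n).kpw (s + 1)) (fun n => kpw_nonneg (hclose.nonnegA n) (s + 1))
    (fun n => kpw_nonneg (hclose.nonnegB n) (s + 1))
    (fun n => kpw_le (hBb n) (hclose.nonnegB n) (hclose.leB n) (s + 1)) hL1
    (fun L hL => exists_integral_listProd_le (by omega) hFam hk L hL)
    (List.ofFn fun r => (u r, v r)) (by
      intro e he
      obtain ⟨r, rfl⟩ := (List.mem_ofFn' _ _).1 he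
      exact huv r)
  have hdens : ∀ W : ℝ → ℝ → ℝ, BddKer W → (∀ x y, W x y = W y x) → graphDensity μ F W =
      ∫ x, listProd (kpw μ W (s + 1)) (List.ofFn fun r => (u r, v r)) x
        ∂(Measure.pi fun _ : Fin k => μ) := by
    intro W hW hs
    rw [graphDensity_iso φ, graphDensity_multiSubdiv (by omega) huv hW hs]
    simp_rw [listProd_ofFn]
  rw [← tendsto_add_atTop_iff_nat 1, tendsto_iff_norm_sub_tendsto_zero]
  refine squeeze_zero (fun n => norm_nonneg _) (fun n => ?_) hlist
  have hPn := ((hclose.bmA n).kpw (μ := μ) (s + 1)).listProd (List.ofFn fun r => (u r, v r))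
  have hQn := ((hBb n).kpw (μ := μ) (s + 1)).listProd (List.ofFn fun r => (u r, v r))
  rw [tDen_eq_graphDensity, homDensity_eq, ← graphDensity_comp hκb F (hτ n).1,
    hdens _ (hclose.bmA n) (hclose.symmA n), hdens _ (hBb n) (hclose.symmB n),
    ← hPn.integral_sub hQn]
  exact norm_integral_le_integral_norm _
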